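/- For all integers k and m with m ≥ k ≥ 4, there exists a finite simple graph G such that cr(G) = k and pcr(G) ≥ m. -/

import Mathlib

open Set

noncomputable section

abbrev Plane : Type := ℝ × ℝ

/-- The setoid on nonzero vectors of `ℝ³` identifying nonzero scalar multiples. -/
def projSetoid : Setoid {v : Fin 3 → ℝ // v ≠ 0} where
  r v w := ∃ c : ℝ, c ≠ 0 ∧ c • v.1 = w.1
  iseqv := by
    constructor
    · exact fun v => ⟨1, one_ne_zero, one_smul _ _⟩
    · rintro v w ⟨c, hc, h⟩
      exact ⟨c⁻¹, inv_ne_zero hc, by rw [← h, smul_smul, inv_mul_cancel₀ hc, one_smul]⟩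
    · rintro u v w ⟨c, hc, h⟩ ⟨d, hd, h'⟩
      exact ⟨d * c, mul_ne_zero hd hc, by rw [← h', ← h, smul_smul]⟩

/-- The real projective plane, as the quotient of `ℝ³ \ {0}` by nonzero scaling. -/
def RP2 : Type := Quotient projSetoid

instance : TopologicalSpace RP2 := instTopologicalSpaceQuotient

/-- The standard affine embedding of the plane in the projective plane. -/
def planeToRP2 (p : Plane) : RP2 :=
  Quotient.mk projSetoid ⟨![p.1, p.2, 1], by
    intro h
    simpa using congrFun h 2⟩

/-- A pseudoline: a simple closed curve in the projective plane that does not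
disconnect it. -/
def IsPseudoline (L : Set RP2) : Prop :=
  ∃ f : AddCircle (1 : ℝ) → RP2,
    Continuous f ∧ Function.Injective f ∧ Set.range f = L ∧ IsConnected Lᶜ

/-- A drawing of a graph in the plane: vertices are distinct points, each edge is a
simple arc (parametrized on `[0,1]`) joining its endpoints, and no arc passes
through a vertex other than its endpoints. -/
structure Drawing {V : Type*} (G : SimpleGraph V) where
  vert : V → Plane
  vert_inj : Function.Injective vert
  arc : G.edgeSet → ℝ → Plane
  arc_cont : ∀ e, ContinuousOn (arc e) (Icc 0 1)
  arc_injOn : ∀ e, InjOn (arc e) (Icc 0 1)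
  arc_ends : ∀ e : G.edgeSet, ∃ x y : V,
    (e : Sym2 V) = s(x, y) ∧ arc e 0 = vert x ∧ arc e 1 = vert y
  arc_avoid : ∀ (e : G.edgeSet) (t : ℝ), t ∈ Icc (0:ℝ) 1 →
    (∃ v, arc e t = vert v) → t = 0 ∨ t = 1

namespace Drawing

variable {V : Type*} {G : SimpleGraph V} (D : Drawing G)

/-- The interior (relative to its endpoints) of the arc of an edge. -/
def interOf (e : G.edgeSet) : Set Plane := D.arc e '' Ioo 0 1

/-- The set of crossings of a drawing: pairs consisting of a point of the plane
together with an (unordered) pair of distinct edges whose interiors both pass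
through the point. -/
def CrossSet : Set (Plane × Sym2 G.edgeSet) :=
  { x | ∃ e f : G.edgeSet, e ≠ f ∧ x.2 = s(e, f) ∧
      x.1 ∈ D.interOf e ∧ x.1 ∈ D.interOf f }

/-- The weighted number of crossings of a drawing: each crossing of a pair of
edges `e`, `f` contributes `w e * w f`. -/
def wcount (w : Sym2 V → ℕ) : ℕ :=
  ∑ᶠ x ∈ D.CrossSet,
    Sym2.lift ⟨fun e f : G.edgeSet => w e * w f, fun e f => mul_comm _ _⟩ x.2

/-- A drawing is pseudolinear if each edge can be extended to a pseudoline of the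
projective plane (via the standard affine embedding of the plane in the projective
plane) so that the extensions form a pseudoline arrangement: any two of the
pseudolines extending distinct edges meet in exactly one point. -/
def IsPseudolinear : Prop :=
  ∃ L : G.edgeSet → Set RP2,
    (∀ e, IsPseudoline (L e)) ∧
    (∀ e, ∀ t ∈ Icc (0:ℝ) 1, planeToRP2 (D.arc e t) ∈ L e) ∧
    (∀ e f, e ≠ f → ∃! p, p ∈ L e ∧ p ∈ L f)

/-- A drawing is rectilinear if every edge is drawn as a straight line segment. -/
def IsRectilinear : Prop :=
  ∀ e, ∀ t ∈ Icc (0:ℝ) 1, D.arc e t = (1 - t) • D.arc e 0 + t • D.arc e 1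

/-- A drawing is x-monotone if every edge meets every vertical line in at most one
point. -/
def IsMonotone : Prop :=
  ∀ e, InjOn (fun t => (D.arc e t).1) (Icc 0 1)

end Drawing

/-- The crossing number of `G` relative to a class of drawings `P`: the minimum
number of crossings in a drawing of `G` satisfying `P` (with finitely many
crossings). -/
def crNumP {V : Type*} (G : SimpleGraph V) (P : Drawing G → Prop) : ℕ :=
  sInf { n | ∃ D : Drawing G, P D ∧ D.CrossSet.Finite ∧ D.CrossSet.ncard = n }

/-- The crossing number `cr G`. -/
def crNum {V : Type*} (G : SimpleGraph V) : ℕ := crNumP G fun _ => True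

/-- The pseudolinear crossing number `pcr G`. -/
def pcrNum {V : Type*} (G : SimpleGraph V) : ℕ := crNumP G Drawing.IsPseudolinear

/-- The rectilinear crossing number `rcr G`. -/
def rcrNum {V : Type*} (G : SimpleGraph V) : ℕ := crNumP G Drawing.IsRectilinear

/-- The monotone crossing number `mon-cr G`. -/
def moncrNum {V : Type*} (G : SimpleGraph V) : ℕ := crNumP G Drawing.IsMonotone

/-- The weighted crossing number of `(G, w)` relative to a class of drawings. -/
def wcrNumP {V : Type*} (G : SimpleGraph V) (w : Sym2 V → ℕ) (P : Drawing G → Prop) : ℕ :=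
  sInf { n | ∃ D : Drawing G, P D ∧ D.CrossSet.Finite ∧ D.wcount w = n }

/-- The weighted crossing number `cr (G, w)`. -/
def wcrNum {V : Type*} (G : SimpleGraph V) (w : Sym2 V → ℕ) : ℕ :=
  wcrNumP G w fun _ => True

/-- The weighted pseudolinear crossing number `pcr (G, w)`. -/
def wpcrNum {V : Type*} (G : SimpleGraph V) (w : Sym2 V → ℕ) : ℕ :=
  wcrNumP G w Drawing.IsPseudolinear

/-- The weighted rectilinear crossing number `rcr (G, w)`. -/
def wrcrNum {V : Type*} (G : SimpleGraph V) (w : Sym2 V → ℕ) : ℕ :=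
  wcrNumP G w Drawing.IsRectilinear

open Complex in
/-- `n` counts the full turns, relative to the principal logarithm, of a path around `z`. -/
def IsTurn (z : ℂ) {a b : ℂ} (γ : Path a b) (n : ℤ) : Prop :=
  ∃ l : C(unitInterval, ℂ), (∀ t, exp (l t) = γ t - z) ∧
    l 1 - l 0 = log (b - z) - log (a - z) + n * (2 * Real.pi * I)

/-- A nowhere vanishing function on a retract of a simply connected space has a logarithm. -/
theorem exists_log_lift {A E : Type*} [TopologicalSpace A] [TopologicalSpace E]
    [SimplyConnectedSpace E] [LocallyPathConnectedSpace E] (s : C(A, E)) (r : C(E, A))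
    (hr : ∀ x, r (s x) = x) (f : C(A, ℂ)) (hf : ∀ x, f x ≠ 0) :
    ∃ F : C(A, ℂ), ∀ x, Complex.exp (F x) = f x := by
  obtain ⟨a⟩ : Nonempty E := inferInstance
  obtain ⟨F, ⟨-, hF⟩, -⟩ := Complex.isCoveringMapOn_exp.existsUnique_continuousMap_lifts (f.comp r)
    (e₀ := Complex.log (f (r a))) (a₀ := a) (Complex.exp_log (hf _)) (by simpa using fun _ => hf _)
  exact ⟨F.comp s, fun x => (congrFun hF (s x)).trans (by simp [hr])⟩

theorem exists_log_lift_unitInterval (f : C(unitInterval, ℂ)) (hf : ∀ x, f x ≠ 0) :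
    ∃ F : C(unitInterval, ℂ), ∀ x, Complex.exp (F x) = f x :=
  exists_log_lift (E := ℝ) ⟨Subtype.val, by fun_prop⟩
    ⟨projIcc 0 1 zero_le_one, continuous_projIcc⟩ (fun x => projIcc_val zero_le_one x) f hf

theorem exists_log_lift_square (f : C(unitInterval × unitInterval, ℂ)) (hf : ∀ x, f x ≠ 0) :
    ∃ F : C(unitInterval × unitInterval, ℂ), ∀ x, Complex.exp (F x) = f x :=
  exists_log_lift (E := ℝ × ℝ) ⟨fun x => (x.1, x.2), by fun_prop⟩
    ⟨fun x => (projIcc 0 1 zero_le_one x.1, projIcc 0 1 zero_le_one x.2),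
      (continuous_projIcc.comp continuous_fst).prodMk (continuous_projIcc.comp continuous_snd)⟩
    (fun x => by simp) f hf

theorem exp_eq_turn {x y w : ℂ} (hx : Complex.exp x = w) (hy : Complex.exp y = w) :
    ∃ n : ℤ, x = y + n * (2 * Real.pi * Complex.I) :=
  Complex.exp_eq_exp_iff_exists_int.1 (hx.trans hy.symm)

section

variable {a b c d z : ℂ}

theorem exists_isTurn (γ : Path a b) (hz : z ∉ range γ) : ∃ n, IsTurn z γ n := by
  have hne : ∀ t, γ t - z ≠ 0 := fun t h => hz ⟨t, sub_eq_zero.1 h⟩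
  obtain ⟨l, hl⟩ := exists_log_lift_unitInterval ⟨fun t => γ t - z, by fun_prop⟩ hne
  have h0 := hne 0
  have h1 := hne 1
  have l0 := hl 0
  have l1 := hl 1
  simp only [ContinuousMap.coe_mk, γ.source, γ.target] at h0 h1 l0 l1
  obtain ⟨n, hn⟩ := exp_eq_turn l0 (Complex.exp_log h0)
  obtain ⟨m, hm⟩ := exp_eq_turn l1 (Complex.exp_log h1)
  refine ⟨m - n, l, hl, ?_⟩
  rw [hn, hm]; push_cast; ring

theorem log_lift_sub_const {f g : C(unitInterval, ℂ)}
    (h : ∀ t, Complex.exp (f t) = Complex.exp (g t)) : f 1 - f 0 = g 1 - g 0 := by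
  obtain ⟨n, hn⟩ := Complex.exp_eq_exp_iff_exists_int.1 (h 0)
  have hc : Continuous fun t => g t + n * (2 * Real.pi * Complex.I) := by fun_prop
  have := Complex.isCoveringMap_exp.eq_of_comp_eq (g₁ := f) (A := unitInterval)
    (g₂ := fun t => g t + n * (2 * Real.pi * Complex.I)) f.continuous hc
    (by
      funext t; ext
      simp only [Function.comp, h]
      rw [Complex.exp_add, Complex.exp_int_mul_two_pi_mul_I, mul_one]) 0 hn
  rw [congrFun this 1, congrFun this 0]; ring

theorem IsTurn.unique {γ : Path a b} {m n : ℤ} (hm : IsTurn z γ m) (hn : IsTurn z γ n) :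
    m = n := by
  obtain ⟨f, hf, hf'⟩ := hm
  obtain ⟨g, hg, hg'⟩ := hn
  have := log_lift_sub_const (f := f) (g := g) fun t => (hf t).trans (hg t).symm
  rw [hf', hg', add_right_inj] at this
  exact_mod_cast mul_right_cancel₀ Complex.two_pi_I_ne_zero this

open Classical in
/-- The parity of the number of turns of a path around `z`. -/
def turn (z : ℂ) {a b : ℂ} (γ : Path a b) : ZMod 2 :=
  if h : ∃ n, IsTurn z γ n then (h.choose : ZMod 2) else 0

theorem IsTurn.turn_eq {γ : Path a b} {n : ℤ} (h : IsTurn z γ n) : turn z γ = n := by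
  have h' : ∃ n, IsTurn z γ n := ⟨n, h⟩
  rw [turn, dif_pos h', h'.choose_spec.unique h]

theorem turn_eq_of_lift {γ : Path a b} {l : C(unitInterval, ℂ)}
    (hl : ∀ t, Complex.exp (l t) = γ t - z) :
    ∃ n : ℤ, turn z γ = n ∧
      l 1 - l 0 = Complex.log (b - z) - Complex.log (a - z) + n * (2 * Real.pi * Complex.I) := by
  have hz : z ∉ range γ := by
    rintro ⟨t, ht⟩
    exact Complex.exp_ne_zero _ ((hl t).trans (sub_eq_zero.2 ht))
  obtain ⟨n, hn⟩ := exists_isTurn γ hz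
  obtain ⟨f, hf, hf'⟩ := id hn
  exact ⟨n, hn.turn_eq, hf' ▸ log_lift_sub_const fun t => (hl t).trans (hf t).symm⟩

theorem exists_lift (γ : Path a b) (hz : z ∉ range γ) :
    ∃ l : C(unitInterval, ℂ), ∀ t, Complex.exp (l t) = γ t - z := by
  obtain ⟨n, l, hl, -⟩ := exists_isTurn γ hz
  exact ⟨l, hl⟩

theorem turn_add_of_reparam {x : ℂ} {γ : Path a b} {γ₁ : Path a x} {γ₂ : Path x b}
    (σ₁ σ₂ : C(unitInterval, unitInterval)) (h₁ : ∀ t, γ₁ t = γ (σ₁ t))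
    (h₂ : ∀ t, γ₂ t = γ (σ₂ t)) (h0 : σ₁ 0 = 0) (hx : σ₁ 1 = σ₂ 0) (h1 : σ₂ 1 = 1)
    (hz : z ∉ range γ) : turn z γ = turn z γ₁ + turn z γ₂ := by
  obtain ⟨l, hl⟩ := exists_lift γ hz
  obtain ⟨n, hn, hn'⟩ := turn_eq_of_lift hl
  obtain ⟨n₁, hn₁, hn₁'⟩ := turn_eq_of_lift (γ := γ₁) (z := z) (l := l.comp σ₁) fun t => by
    simp [hl, h₁]
  obtain ⟨n₂, hn₂, hn₂'⟩ := turn_eq_of_lift (γ := γ₂) (z := z) (l := l.comp σ₂) fun t => by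
    simp [hl, h₂]
  rw [hn, hn₁, hn₂]
  simp only [ContinuousMap.comp_apply, h0, hx, h1] at hn₁' hn₂'
  have : (n : ℂ) * (2 * Real.pi * Complex.I) = (n₁ + n₂) * (2 * Real.pi * Complex.I) := by
    linear_combination hn₁' + hn₂' - hn'
  have := mul_right_cancel₀ Complex.two_pi_I_ne_zero this
  exact_mod_cast congrArg (Int.cast : ℤ → ZMod 2) (by exact_mod_cast this : n = n₁ + n₂)

theorem turn_trans {x : ℂ} (γ : Path a x) (δ : Path x b) (hγ : z ∉ range γ) (hδ : z ∉ range δ) :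
    turn z (γ.trans δ) = turn z γ + turn z δ := by
  refine turn_add_of_reparam
    ⟨fun t => ⟨t / 2, by constructor <;> linarith [t.2.1, t.2.2]⟩, by fun_prop⟩
    ⟨fun t => ⟨(t + 1) / 2, by constructor <;> linarith [t.2.1, t.2.2]⟩, by fun_prop⟩
    ?_ ?_ ?_ ?_ ?_ ?_
  · intro t
    rw [Path.trans_apply, dif_pos]
    · congr 1; ext; simp; ring
    · simp only [ContinuousMap.coe_mk]; linarith [t.2.2]
  · intro t
    rcases eq_or_ne t 0 with rfl | ht
    · rw [Path.trans_apply, dif_pos (by simp)]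
      simp only [ContinuousMap.coe_mk]
      rw [δ.source, eq_comm]
      convert γ.target; simp
    · rw [Path.trans_apply, dif_neg]
      · congr 1; ext; simp; ring
      · have : (0 : ℝ) < t := lt_of_le_of_ne t.2.1 fun h => ht (Subtype.ext h.symm)
        simp only [ContinuousMap.coe_mk]; linarith
  · ext; simp
  · ext; simp
  · ext; simp
  · rw [Path.trans_range]; exact fun h => h.elim hγ hδ

theorem turn_symm (γ : Path a b) : turn z γ.symm = turn z γ := by
  by_cases hz : z ∈ range γ
  · have key : ∀ {a b : ℂ} (γ : Path a b), z ∈ range γ → turn z γ = 0 := fun γ ⟨t, ht⟩ =>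
      dif_neg fun ⟨n, l, hl, _⟩ => Complex.exp_ne_zero _ ((hl t).trans (sub_eq_zero.2 ht))
    rw [key γ hz, key γ.symm (by rwa [Path.symm_range])]
  obtain ⟨l, hl⟩ := exists_lift γ hz
  obtain ⟨n, hn, hn'⟩ := turn_eq_of_lift hl
  obtain ⟨m, hm, hm'⟩ := turn_eq_of_lift (γ := γ.symm) (z := z)
    (l := l.comp ⟨unitInterval.symm, by fun_prop⟩) fun t => by simp [hl, Path.symm_apply]
  simp only [ContinuousMap.comp_apply, ContinuousMap.coe_mk, unitInterval.symm_zero,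
    unitInterval.symm_one] at hm'
  have : (m : ℂ) * (2 * Real.pi * Complex.I) = (-n) * (2 * Real.pi * Complex.I) := by
    linear_combination -hm' - hn'
  have := mul_right_cancel₀ Complex.two_pi_I_ne_zero this
  rw [hm, hn, (by exact_mod_cast this : m = -n), Int.cast_neg, CharTwo.neg_eq]

/-- Splitting a path at one of its points. -/
theorem exists_split (γ : Path a b) {x : ℂ} (hx : x ∈ range γ) :
    ∃ (γ₁ : Path a x) (γ₂ : Path x b), range γ = range γ₁ ∪ range γ₂ ∧
      (∀ z, z ∉ range γ → turn z γ = turn z γ₁ + turn z γ₂) ∧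
      (Function.Injective γ → range γ₁ ∩ range γ₂ = {x} ∧
        (a ≠ x → Function.Injective γ₁) ∧ (x ≠ b → Function.Injective γ₂)) := by
  obtain ⟨s, rfl⟩ := hx
  have hs0 := s.2.1
  have hs1 := s.2.2
  let σ₁ : C(unitInterval, unitInterval) :=
    ⟨fun t => ⟨s * t, by
      constructor <;> nlinarith [t.2.1, t.2.2]⟩, by fun_prop⟩
  let σ₂ : C(unitInterval, unitInterval) :=
    ⟨fun t => ⟨s + (1 - s) * t, by
      constructor <;> nlinarith [t.2.1, t.2.2]⟩, by fun_prop⟩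
  have e1 : σ₁ 0 = 0 := by ext; simp [σ₁]
  have e2 : σ₁ 1 = s := by ext; simp [σ₁]
  have e3 : σ₂ 0 = s := by ext; simp [σ₂]
  have e4 : σ₂ 1 = 1 := by ext; simp [σ₂]
  let γ₁ : Path a (γ s) := ⟨γ.toContinuousMap.comp σ₁, by simp [e1], by simp [e2]⟩
  let γ₂ : Path (γ s) b := ⟨γ.toContinuousMap.comp σ₂, by simp [e3], by simp [e4]⟩
  have h1 : ∀ t, γ₁ t = γ (σ₁ t) := fun t => rfl
  have h2 : ∀ t, γ₂ t = γ (σ₂ t) := fun t => rfl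
  refine ⟨γ₁, γ₂, ?_, fun z hz => turn_add_of_reparam σ₁ σ₂ h1 h2 e1 (e2.trans e3.symm) e4 hz,
    fun hi => ⟨?_, ?_, ?_⟩⟩
  · apply Subset.antisymm
    · rintro _ ⟨t, rfl⟩
      rcases le_total (t : ℝ) s with h | h
      · left
        rcases hs0.eq_or_lt with h0 | h0
        · refine ⟨0, ?_⟩
          rw [h1, e1]; congr 1; ext; simp; linarith [t.2.1]
        · refine ⟨⟨t / s, by rw [mem_Icc, le_div_iff₀ h0, div_le_one h0]; simpa using ⟨t.2.1, h⟩⟩, ?_⟩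
          rw [h1]; congr 1; ext; simp [σ₁]; field_simp
      · right
        rcases hs1.eq_or_lt with h0 | h0
        · refine ⟨1, ?_⟩
          rw [h2, e4]; congr 1; ext; simp; linarith [t.2.2]
        · have h0' : (0 : ℝ) < 1 - s := by linarith
          refine ⟨⟨(t - s) / (1 - s), by
            rw [mem_Icc, le_div_iff₀ h0', div_le_one h0']; constructor <;> linarith [t.2.2]⟩, ?_⟩
          rw [h2]; congr 1; ext; simp [σ₂]; field_simp; ring
    · rintro _ (⟨t, rfl⟩ | ⟨t, rfl⟩)
      · exact ⟨_, (h1 t).symm⟩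
      · exact ⟨_, (h2 t).symm⟩
  · ext w
    simp only [mem_inter_iff, mem_range, mem_singleton_iff]
    constructor
    · rintro ⟨⟨t, rfl⟩, r, hr⟩
      rw [h1, h2] at hr
      have := congrArg Subtype.val (hi hr)
      simp only [σ₁, σ₂, ContinuousMap.coe_mk] at this
      rw [h1]; congr 1; ext
      simp only [σ₁, ContinuousMap.coe_mk]
      nlinarith [t.2.1, t.2.2, r.2.1, r.2.2]
    · rintro rfl
      exact ⟨⟨1, by simp⟩, ⟨0, by simp⟩⟩
  · intro hne t r htr
    have hs : (s : ℝ) ≠ 0 := fun h => hne (by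
      rw [(Subtype.ext h : s = 0), γ.source])
    have := congrArg Subtype.val (hi ((h1 t).symm.trans (htr.trans (h1 r))))
    simp only [σ₁, ContinuousMap.coe_mk] at this
    exact Subtype.ext (mul_left_cancel₀ hs this)
  · intro hne t r htr
    have hs : 1 - (s : ℝ) ≠ 0 := fun h => hne (by
      rw [(Subtype.ext (sub_eq_zero.1 h).symm : s = 1), γ.target])
    have := congrArg Subtype.val (hi ((h2 t).symm.trans (htr.trans (h2 r))))
    simp only [σ₂, ContinuousMap.coe_mk, add_right_inj] at this
    exact Subtype.ext (mul_left_cancel₀ hs this)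

/-- The half plane, bounded by the horizontal line through `z`, that contains `w`. -/
def half (z w : ℂ) : ZMod 2 := if 0 < Complex.arg (w - z) then 1 else 0

theorem half_int {z w : ℂ} (h : z ≠ w) : ∃ n : ℤ, half z w = n ∧
    Complex.log (w - z) - Complex.log (z - w) = (2 * n - 1) * (Real.pi * Complex.I) := by
  have h0 : w - z ≠ 0 := sub_ne_zero.2 h.symm
  rw [← neg_sub w z]
  unfold half Complex.log
  rw [norm_neg]
  split_ifs with ha
  · refine ⟨1, by simp, ?_⟩
    have : Complex.arg (-(w - z)) = Complex.arg (w - z) - Real.pi := by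
      rw [Complex.arg_neg_eq_arg_sub_pi_iff]
      rcases lt_trichotomy (w - z).im 0 with hi | hi | hi
      · exact absurd (Complex.arg_neg_iff.2 hi) (by linarith)
      · exact Or.inr ⟨hi, by
          by_contra hr
          exact absurd (Complex.arg_eq_zero_iff.2 ⟨not_lt.1 hr, hi⟩) ha.ne'⟩
      · exact Or.inl hi
    rw [this]; push_cast; ring
  · refine ⟨0, by simp, ?_⟩
    have : Complex.arg (-(w - z)) = Complex.arg (w - z) + Real.pi := by
      rw [Complex.arg_neg_eq_arg_add_pi_iff]
      rcases lt_trichotomy (w - z).im 0 with hi | hi | hi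
      · exact Or.inl hi
      · exact Or.inr ⟨hi, by
          by_contra hr
          have : (w - z).re < 0 := lt_of_le_of_ne (not_lt.1 hr) fun h => h0 (Complex.ext h hi)
          exact ha (by rw [Complex.arg_eq_pi_iff.2 ⟨this, hi⟩]; exact Real.pi_pos)⟩
      · exact absurd (by
          have h1 := Complex.arg_nonneg_iff.2 hi.le
          refine lt_of_le_of_ne h1 fun h2 => ?_
          exact hi.ne' (Complex.arg_eq_zero_iff.1 h2.symm).2) ha
    rw [this]; push_cast; ring

theorem half_swap {z w : ℂ} (h : z ≠ w) : half w z = half z w + 1 := by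
  obtain ⟨n, hn, hn'⟩ := half_int h
  obtain ⟨m, hm, hm'⟩ := half_int h.symm
  have : ((m + n : ℤ) : ℂ) * (2 * (Real.pi * Complex.I)) = (1 : ℤ) * (2 * (Real.pi * Complex.I)) := by
    push_cast
    linear_combination -hn' - hm'
  have := mul_right_cancel₀ (by simp [Real.pi_ne_zero]) this
  have h1 : m = 1 - n := by
    have : m + n = 1 := by exact_mod_cast this
    omega
  rw [hn, hm, h1]
  push_cast
  rw [sub_eq_add_neg, CharTwo.neg_eq, add_comm]

/-- The parity of the number of crossings of two paths. -/
def cross (γ : Path a b) (δ : Path c d) : ZMod 2 :=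
  half c b + half c a + half d b + half d a + turn c γ + turn d γ + turn a δ + turn b δ

theorem cross_eq_zero_of_disjoint (γ : Path a b) (δ : Path c d)
    (h : Disjoint (range γ) (range δ)) : cross γ δ = 0 := by
  have hne : ∀ s t, γ s ≠ δ t := fun s t => h.ne_of_mem ⟨s, rfl⟩ ⟨t, rfl⟩
  obtain ⟨F, hF⟩ := exists_log_lift_square ⟨fun x => γ x.1 - δ x.2, by fun_prop⟩
    fun x => sub_ne_zero.2 (hne _ _)
  simp only [ContinuousMap.coe_mk, Prod.forall] at hF
  obtain ⟨n₁, k₁, e₁⟩ := turn_eq_of_lift (γ := γ) (z := c)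
    (l := ⟨fun t => F (t, 0), by fun_prop⟩) fun t => by simp [hF]
  obtain ⟨n₂, k₂, e₂⟩ := turn_eq_of_lift (γ := γ) (z := d)
    (l := ⟨fun t => F (t, 1), by fun_prop⟩) fun t => by simp [hF]
  obtain ⟨n₃, k₃, e₃⟩ := turn_eq_of_lift (γ := δ) (z := a)
    (l := ⟨fun t => F (0, t) + Real.pi * Complex.I, by fun_prop⟩) fun t => by
      simp [hF, Complex.exp_add]
  obtain ⟨n₄, k₄, e₄⟩ := turn_eq_of_lift (γ := δ) (z := b)
    (l := ⟨fun t => F (1, t) + Real.pi * Complex.I, by fun_prop⟩) fun t => by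
      simp [hF, Complex.exp_add]
  simp only [ContinuousMap.coe_mk] at e₁ e₂ e₃ e₄
  have hac := hne 0 0
  have had := hne 0 1
  have hbc := hne 1 0
  have hbd := hne 1 1
  simp only [γ.source, γ.target, δ.source, δ.target] at hac had hbc hbd
  obtain ⟨m₁, j₁, f₁⟩ := half_int hbc.symm
  obtain ⟨m₂, j₂, f₂⟩ := half_int hac.symm
  obtain ⟨m₃, j₃, f₃⟩ := half_int hbd.symm
  obtain ⟨m₄, j₄, f₄⟩ := half_int had.symm
  have : ((m₁ - m₂ - m₃ + m₄ + n₁ - n₂ - n₃ + n₄ : ℤ) : ℂ) * (2 * Real.pi * Complex.I) =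
      (0 : ℤ) * (2 * Real.pi * Complex.I) := by
    push_cast
    linear_combination -f₁ + f₂ + f₃ - f₄ - e₁ + e₂ + e₃ - e₄
  have := mul_right_cancel₀ Complex.two_pi_I_ne_zero this
  have := congrArg (Int.cast : ℤ → ZMod 2) (by exact_mod_cast this :
    m₁ - m₂ - m₃ + m₄ + n₁ - n₂ - n₃ + n₄ = 0)
  rw [cross, k₁, k₂, k₃, k₄, j₁, j₂, j₃, j₄, ← this.trans Int.cast_zero]
  push_cast
  simp only [CharTwo.sub_eq_add]

end

theorem k4_parity {u v x y p q : ℂ} (ux : Path u x) (uy : Path u y) (vx : Path v x)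
    (vy : Path v y) (uq : Path u q) (vq : Path v q) (xp : Path x p) (yp : Path y p)
    (hne : [u, v, x, y, p, q].Nodup)
    (h₁ : cross ux vy = 0) (h₂ : cross uy vx = 0)
    (h₃ : cross uq vx = 0) (h₄ : cross uq vy = 0) (h₅ : cross uq xp = 0) (h₆ : cross uq yp = 0)
    (h₇ : cross vq ux = 0) (h₈ : cross vq uy = 0) (h₉ : cross vq xp = 0) (h₁₀ : cross vq yp = 0)
    (h₁₁ : cross xp uy = 0) (h₁₂ : cross xp vy = 0)
    (h₁₃ : cross yp ux = 0) (h₁₄ : cross yp vx = 0) :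
    turn p ux + turn p uy + turn p vx + turn p vy +
      (turn q ux + turn q uy + turn q vx + turn q vy) = 1 := by
  simp only [List.nodup_cons, List.mem_cons, List.not_mem_nil, or_false, not_or] at hne
  obtain ⟨⟨uv, ux', uy', up, uq'⟩, ⟨vx', vy', vp, vq'⟩, ⟨xy, xp', xq⟩, ⟨yp', yq⟩, pq, -⟩ := hne
  simp only [cross] at *
  have := half_swap uv
  have := half_swap ux'
  have := half_swap uy'
  have := half_swap up
  have := half_swap uq'
  have := half_swap vx'
  have := half_swap vy'
  have := half_swap vp
  have := half_swap vq'
  have := half_swap xy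
  have := half_swap xp'
  have := half_swap xq
  have := half_swap yp'
  have := half_swap yq
  have := half_swap pq
  grind

section

variable {a b c d x y z w : ℂ}

theorem cross_comm (γ : Path a b) (δ : Path c d) (ha : a ∉ range δ) (hb : b ∉ range δ) :
    cross γ δ = cross δ γ := by
  have h1 : c ≠ a := fun h => ha ⟨0, by simp [h]⟩
  have h2 : d ≠ a := fun h => ha ⟨1, by simp [h]⟩
  have h3 : c ≠ b := fun h => hb ⟨0, by simp [h]⟩
  have h4 : d ≠ b := fun h => hb ⟨1, by simp [h]⟩
  have := half_swap h1
  have := half_swap h2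
  have := half_swap h3
  have := half_swap h4
  simp only [cross]
  grind

@[simp] theorem cross_symm_left (γ : Path a b) (δ : Path c d) : cross γ.symm δ = cross γ δ := by
  simp only [cross, turn_symm]; ring

@[simp] theorem cross_symm_right (γ : Path a b) (δ : Path c d) : cross γ δ.symm = cross γ δ := by
  simp only [cross, turn_symm]; ring

theorem cross_add_left {γ : Path a b} {γ₁ : Path a x} {γ₂ : Path x b} {δ : Path c d}
    (hc : turn c γ = turn c γ₁ + turn c γ₂) (hd : turn d γ = turn d γ₁ + turn d γ₂) :
    cross γ δ = cross γ₁ δ + cross γ₂ δ := by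
  simp only [cross, hc, hd]; grind

/-- Two paths, neither containing an endpoint of the other, that meet in at most one point and do
not cross there. -/
structure Uncrossed (γ : Path a b) (δ : Path c d) : Prop where
  left : a ∉ range δ
  right : b ∉ range δ
  left' : c ∉ range γ
  right' : d ∉ range γ
  meet : (range γ ∩ range δ).Subsingleton
  cross_eq : cross γ δ = 0

theorem Uncrossed.of_disjoint {γ : Path a b} {δ : Path c d} (h : Disjoint (range γ) (range δ)) :
    Uncrossed γ δ where
  left := h.notMem_of_mem_left ⟨0, γ.source⟩
  right := h.notMem_of_mem_left ⟨1, γ.target⟩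
  left' := h.notMem_of_mem_right ⟨0, δ.source⟩
  right' := h.notMem_of_mem_right ⟨1, δ.target⟩
  meet := by simp [h.inter_eq]
  cross_eq := cross_eq_zero_of_disjoint γ δ h

theorem Uncrossed.swap {γ : Path a b} {δ : Path c d} (h : Uncrossed γ δ) : Uncrossed δ γ :=
  ⟨h.left', h.right', h.left, h.right, inter_comm (range γ) _ ▸ h.meet,
    cross_comm γ δ h.left h.right ▸ h.cross_eq⟩

theorem Uncrossed.symm_left {γ : Path a b} {δ : Path c d} (h : Uncrossed γ δ) :
    Uncrossed γ.symm δ :=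
  ⟨h.right, h.left, by simpa using h.left', by simpa using h.right', by simpa using h.meet,
    by simpa using h.cross_eq⟩

/-- `γ` is cut at `x` into `γ₁` and `γ₂`. -/
structure IsSplit (γ : Path a b) (γ₁ : Path a x) (γ₂ : Path x b) : Prop where
  range_eq : range γ = range γ₁ ∪ range γ₂
  turn_eq : ∀ z, z ∉ range γ → turn z γ = turn z γ₁ + turn z γ₂
  inter_eq : range γ₁ ∩ range γ₂ = {x}

theorem IsSplit.symm {γ : Path a b} {γ₁ : Path a x} {γ₂ : Path x b} (h : IsSplit γ γ₁ γ₂) :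
    IsSplit γ.symm γ₂.symm γ₁.symm where
  range_eq := by simp [h.range_eq, union_comm]
  turn_eq z hz := by
    simp only [turn_symm]; rw [h.turn_eq z (by simpa using hz), add_comm]
  inter_eq := by simp [← h.inter_eq, inter_comm]

theorem exists_isSplit (γ : Path a b) (hγ : Function.Injective γ) (hx : x ∈ range γ) :
    ∃ (γ₁ : Path a x) (γ₂ : Path x b), IsSplit γ γ₁ γ₂ :=
  let ⟨γ₁, γ₂, h1, h2, h3⟩ := exists_split γ hx
  ⟨γ₁, γ₂, h1, h2, (h3 hγ).1⟩

theorem IsSplit.uncrossed_fst {γ : Path a b} {γ₁ : Path a x} {γ₂ : Path x b} {δ : Path c d}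
    (h : IsSplit γ γ₁ γ₂) (hu : Uncrossed γ δ) (hx : x ∉ range δ) : Uncrossed γ₁ δ := by
  have h1 : range γ₁ ⊆ range γ := h.range_eq ▸ subset_union_left
  have h2 : range γ₂ ⊆ range γ := h.range_eq ▸ subset_union_right
  refine ⟨hu.left, hx, fun h => hu.left' (h1 h), fun h => hu.right' (h1 h),
    hu.meet.anti (inter_subset_inter_left _ h1), ?_⟩
  by_cases hd : Disjoint (range γ₁) (range δ)
  · exact cross_eq_zero_of_disjoint _ _ hd
  · obtain ⟨p, hp, hp'⟩ := not_disjoint_iff.1 hd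
    have hd' : Disjoint (range γ₂) (range δ) := by
      rw [Set.disjoint_left]
      intro q hq hq'
      obtain rfl := hu.meet ⟨h1 hp, hp'⟩ ⟨h2 hq, hq'⟩
      have : p ∈ ({x} : Set ℂ) := h.inter_eq ▸ ⟨hp, hq⟩
      exact hx (this ▸ hp')
    have := cross_add_left (δ := δ) (h.turn_eq c hu.left') (h.turn_eq d hu.right')
    rw [hu.cross_eq, cross_eq_zero_of_disjoint _ _ hd', add_zero] at this
    exact this.symm

theorem IsSplit.uncrossed_snd {γ : Path a b} {γ₁ : Path a x} {γ₂ : Path x b} {δ : Path c d}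
    (h : IsSplit γ γ₁ γ₂) (hu : Uncrossed γ δ) (hx : x ∉ range δ) : Uncrossed γ₂ δ := by
  simpa using (h.symm.uncrossed_fst hu.symm_left hx).symm_left

theorem Uncrossed.cross_trans {γ₁ : Path a x} {γ₂ : Path x b} {δ : Path c d}
    (h₁ : Uncrossed γ₁ δ) (h₂ : Uncrossed γ₂ δ) : cross (γ₁.trans γ₂) δ = 0 := by
  rw [cross_add_left (turn_trans γ₁ γ₂ h₁.left' h₂.left') (turn_trans γ₁ γ₂ h₁.right' h₂.right'),
    h₁.cross_eq, h₂.cross_eq, add_zero]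

theorem triangle_parity {u v : ℂ} (e : Path u a) (g : Path a b) (h : Path u b)
    (f : Path v c) (k : Path c d) (l : Path v d)
    (huv : u ≠ v) (huc : u ≠ c) (hud : u ≠ d) (hav : a ≠ v) (hac : a ≠ c) (had : a ≠ d)
    (hbv : b ≠ v) (hbc : b ≠ c) (hbd : b ≠ d)
    (ek : cross e k = 0) (el : cross e l = 0) (gf : cross g f = 0) (gk : cross g k = 0)
    (gl : cross g l = 0) (hf : cross h f = 0) (hk : cross h k = 0) (hl : cross h l = 0) :
    cross e f = 0 := by
  have := half_swap huv
  have := half_swap huc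
  have := half_swap hud
  have := half_swap hav
  have := half_swap hac
  have := half_swap had
  have := half_swap hbv
  have := half_swap hbc
  have := half_swap hbd
  simp only [cross] at *
  grind

/-- The two ends of a path that crosses each of four arcs forming a closed curve evenly. -/
theorem quad_parity {u v : ℂ} (ux : Path u x) (vx : Path v x) (vy : Path v y) (uy : Path u y)
    (δ : Path c d) :
    cross ux δ + cross vx δ + cross vy δ + cross uy δ =
      turn c ux + turn c vx + turn c vy + turn c uy +
        (turn d ux + turn d vx + turn d vy + turn d uy) := by
  simp only [cross]
  grind

theorem loop_parity (C : Path x x) (δ : Path c d) : cross C δ = turn c C + turn d C := by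
  simp only [cross]
  grind

theorem turn_loop_eq_of_disjoint (C : Path x x) (δ : Path c d)
    (h : Disjoint (range C) (range δ)) : turn c C = turn d C := by
  have := loop_parity C δ
  rw [cross_eq_zero_of_disjoint C δ h] at this
  grind

theorem turn_loop_eq_of_convex (C : Path x x) {s : Set ℂ} (hs : Convex ℝ s)
    (h : Disjoint (range C) s) (hz : z ∈ s) (hw : w ∈ s) : turn z C = turn w C := by
  refine turn_loop_eq_of_disjoint C (Path.segment z w) (h.mono_right ?_)
  rw [Path.range_segment]
  exact hs.segment_subset hz hw

theorem turn_loop_far (C : Path x x) {R : ℝ} (hC : ∀ t, ‖C t‖ < R) (hz : R ≤ ‖z‖) :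
    turn z C = 0 := by
  have hz0 : -z ≠ 0 := by
    rw [neg_ne_zero, ← norm_pos_iff]
    exact (norm_nonneg _).trans_lt ((hC 0).trans_le hz)
  have hslit : ∀ t, (C t - z) / -z ∈ Complex.slitPlane := by
    intro t
    have : (C t - z) / -z = 1 - C t / z := by
      have := neg_ne_zero.1 hz0
      field_simp; ring
    rw [this]
    refine Or.inl ?_
    have h1 : (C t / z).re ≤ ‖C t / z‖ := Complex.re_le_norm _
    have h2 : ‖C t / z‖ < 1 := by
      rw [norm_div, div_lt_one (norm_pos_iff.2 (neg_ne_zero.1 hz0))]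
      exact (hC t).trans_le hz
    simp; linarith
  have hcont : Continuous fun t => Complex.log ((C t - z) / -z) + Complex.log (-z) :=
    (Continuous.clog (by fun_prop) hslit).add continuous_const
  obtain ⟨n, hn, hn'⟩ := turn_eq_of_lift (γ := C) (z := z) (l := ⟨_, hcont⟩) fun t => by
    have h0 : (C t - z) / -z ≠ 0 := Complex.slitPlane_ne_zero (hslit t)
    simp only [ContinuousMap.coe_mk]
    rw [Complex.exp_add, Complex.exp_log h0, Complex.exp_log hz0, div_mul_cancel₀ _ hz0]
  simp only [ContinuousMap.coe_mk, C.source, C.target, sub_self, zero_add] at hn'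
  have : (n : ℂ) = 0 := (mul_eq_zero.1 hn'.symm).resolve_right Complex.two_pi_I_ne_zero
  rw [hn, (by exact_mod_cast this : n = 0), Int.cast_zero]

theorem turn_loop_eventually (C : Path x x) (hz : z ∉ range C) :
    ∀ᶠ w in nhds z, w ∉ range C ∧ turn w C = turn z C := by
  have hc : IsClosed (range C) := (isCompact_range C.continuous).isClosed
  obtain ⟨ε, hε, hb⟩ := Metric.isOpen_iff.1 hc.isOpen_compl z hz
  filter_upwards [Metric.ball_mem_nhds z hε] with w hw
  exact ⟨hb hw, turn_loop_eq_of_convex C (convex_ball z ε)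
    (Set.disjoint_left.2 fun p hp hp' => hb hp' hp) hw (Metric.mem_ball_self hε)⟩

theorem exists_loop_bound (C : Path x y) : ∃ R : ℝ, ∀ t, ‖C t‖ < R := by
  obtain ⟨R, hR⟩ := (isCompact_range C.continuous).isBounded.exists_norm_le
  exact ⟨R + 1, fun t => (hR _ ⟨t, rfl⟩).trans_lt (lt_add_one R)⟩

/-- Two closed curves with countably many common points are not both inside each other. -/
theorem not_mutually_inside (C : Path x x) (C' : Path y y)
    (hc : (range C ∩ range C').Countable) (hne : (range C \ range C').Nonempty)
    (h : ∀ z ∈ range C, z ∉ range C' → turn z C' = 1)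
    (h' : ∀ z ∈ range C', z ∉ range C → turn z C = 1) : False := by
  set T := range C ∩ range C' with hT
  have hconn : IsConnected Tᶜ := hc.isConnected_compl_of_one_lt_rank (by
    rw [Complex.rank_real_complex]; exact_mod_cast one_lt_two)
  let E : Set ℂ := {z | z ∉ range C ∧ z ∉ range C' ∧ turn z C = 0 ∧ turn z C' = 0}
  have hE : IsOpen E := by
    rw [isOpen_iff_mem_nhds]
    rintro z ⟨h1, h2, h3, h4⟩
    filter_upwards [turn_loop_eventually C h1, turn_loop_eventually C' h2] with w hw hw'
    exact ⟨hw.1, hw'.1, hw.2.trans h3, hw'.2.trans h4⟩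
  let F : Set ℂ := {z | (z ∉ range C ∧ turn z C = 1) ∨ (z ∉ range C' ∧ turn z C' = 1)}
  have hF : IsOpen F := by
    rw [isOpen_iff_mem_nhds]
    rintro z (⟨h1, h2⟩ | ⟨h1, h2⟩)
    · filter_upwards [turn_loop_eventually C h1] with w hw
      exact Or.inl ⟨hw.1, hw.2.trans h2⟩
    · filter_upwards [turn_loop_eventually C' h1] with w hw
      exact Or.inr ⟨hw.1, hw.2.trans h2⟩
  have h01 : ∀ q : ZMod 2, q = 0 ∨ q = 1 := by decide
  have hcov : Tᶜ ⊆ E ∪ F := by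
    intro z hz
    by_cases hzC : z ∈ range C
    · have hzC' : z ∉ range C' := fun h => hz ⟨hzC, h⟩
      exact Or.inr (Or.inr ⟨hzC', h z hzC hzC'⟩)
    by_cases hzC' : z ∈ range C'
    · exact Or.inr (Or.inl ⟨hzC, h' z hzC' hzC⟩)
    rcases h01 (turn z C) with h1 | h1
    · rcases h01 (turn z C') with h2 | h2
      · exact Or.inl ⟨hzC, hzC', h1, h2⟩
      · exact Or.inr (Or.inr ⟨hzC', h2⟩)
    · exact Or.inr (Or.inl ⟨hzC, h1⟩)
  obtain ⟨R, hR⟩ := exists_loop_bound C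
  obtain ⟨R', hR'⟩ := exists_loop_bound C'
  have hfar : ∃ z : ℂ, z ∈ E := by
    have hr0 : 0 < R := (norm_nonneg _).trans_lt (hR 0)
    have hn : ‖((max R R' : ℝ) : ℂ)‖ = max R R' := by
      rw [Complex.norm_real, Real.norm_of_nonneg (hr0.le.trans (le_max_left _ _))]
    refine ⟨(max R R' : ℝ), ?_, ?_, turn_loop_far C hR (hn.symm ▸ le_max_left _ _),
      turn_loop_far C' hR' (hn.symm ▸ le_max_right _ _)⟩
    · rintro ⟨t, ht⟩
      have := hR t
      rw [ht, hn] at this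
      exact (le_max_left R R').not_gt this
    · rintro ⟨t, ht⟩
      have := hR' t
      rw [ht, hn] at this
      exact (le_max_right R R').not_gt this
  obtain ⟨z, hz⟩ := hfar
  obtain ⟨w, hw, hw'⟩ := hne
  obtain ⟨q, -, hqE, hqF⟩ := hconn.isPreconnected E F hE hF hcov
    ⟨z, fun h => hz.1 h.1, hz⟩ ⟨w, fun h => hw' h.2, Or.inr ⟨hw', h w hw hw'⟩⟩
  rcases hqF with ⟨-, h1⟩ | ⟨-, h1⟩
  · exact zero_ne_one (hqE.2.2.1.symm.trans h1)
  · exact zero_ne_one (hqE.2.2.2.symm.trans h1)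

end

/-- The vertices of the base graph: two poles and, on each of the two sides of each of its two
copies, two further vertices. -/
inductive BaseVertex
  | u | v
  | a (i s : Bool) | b (i s : Bool)
  deriving DecidableEq, Fintype

/-- The edges of the base graph: the light edges `la`, `lb`, and the heavy ones. -/
inductive BaseEdge
  | la (i s : Bool) | lb (i s : Bool)
  | hu (i s : Bool) | hm (i s : Bool) | hv (i s : Bool)
  | ra (i : Bool) | rb (i : Bool)
  deriving DecidableEq, Fintype

namespace BaseEdge

def src : BaseEdge → BaseVertex
  | la _ _ => .u
  | lb _ _ => .v
  | hu _ _ => .u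
  | hm i s => .b i s
  | hv i s => .a i s
  | ra i => .a i false
  | rb i => .b i false

def tgt : BaseEdge → BaseVertex
  | la i s => .a i s
  | lb i s => .b i s
  | hu i s => .b i s
  | hm i s => .a i s
  | hv _ _ => .v
  | ra i => .a i true
  | rb i => .b i true

def light : BaseEdge → Bool
  | la _ _ => true
  | lb _ _ => true
  | _ => false

/-- Having no common end. -/
def Indep (e f : BaseEdge) : Prop :=
  e.src ≠ f.src ∧ e.src ≠ f.tgt ∧ e.tgt ≠ f.src ∧ e.tgt ≠ f.tgt

instance (e f : BaseEdge) : Decidable (e.Indep f) :=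
  inferInstanceAs (Decidable (_ ∧ _))

end BaseEdge

open BaseEdge

/-- A drawing of the base graph in which only light edges cross, at most once each pair. -/
structure Frame where
  pt : BaseVertex → ℂ
  pt_inj : Function.Injective pt
  arc : ∀ e : BaseEdge, Path (pt e.src) (pt e.tgt)
  arc_inj : ∀ e, Function.Injective (arc e)
  avoid : ∀ e x, pt x ∈ range (arc e) → x = e.src ∨ x = e.tgt
  disj : ∀ e f : BaseEdge, e.Indep f → (e.light && f.light) = false →
    Disjoint (range (arc e)) (range (arc f))
  adj : ∀ e f : BaseEdge, ∀ x, e ≠ f → (x = e.src ∨ x = e.tgt) → (x = f.src ∨ x = f.tgt) →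
    range (arc e) ∩ range (arc f) ⊆ {pt x}
  meet : ∀ e f : BaseEdge, e ≠ f → (range (arc e) ∩ range (arc f)).Subsingleton

namespace Frame

variable (F : Frame)

theorem pt_ne {x y : BaseVertex} (h : x ≠ y) : F.pt x ≠ F.pt y := F.pt_inj.ne h

def la (i s : Bool) : Path (F.pt .u) (F.pt (.a i s)) := F.arc (.la i s)
def lb (i s : Bool) : Path (F.pt .v) (F.pt (.b i s)) := F.arc (.lb i s)
def hu (i s : Bool) : Path (F.pt .u) (F.pt (.b i s)) := F.arc (.hu i s)
def hm (i s : Bool) : Path (F.pt (.b i s)) (F.pt (.a i s)) := F.arc (.hm i s)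
def hv (i s : Bool) : Path (F.pt (.a i s)) (F.pt .v) := F.arc (.hv i s)

def ra (i : Bool) : ∀ s, Path (F.pt (.a i s)) (F.pt (.a i !s))
  | false => F.arc (.ra i)
  | true => (F.arc (.ra i)).symm

def rb (i : Bool) : ∀ s, Path (F.pt (.b i s)) (F.pt (.b i !s))
  | false => F.arc (.rb i)
  | true => (F.arc (.rb i)).symm

theorem range_ra (i s : Bool) : range (F.ra i s) = range (F.arc (.ra i)) := by
  cases s
  · rfl
  · exact Path.symm_range _

theorem range_rb (i s : Bool) : range (F.rb i s) = range (F.arc (.rb i)) := by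
  cases s
  · rfl
  · exact Path.symm_range _

theorem uncrossed_la_lb {i s j t : Bool} (h : (i, s) ≠ (j, t)) :
    Uncrossed (F.la i s) (F.lb j t) := by
  have hav : ∀ e x, x ≠ BaseEdge.src e → x ≠ BaseEdge.tgt e → F.pt x ∉ range (F.arc e) :=
    fun e x h1 h2 h3 => (F.avoid e x h3).elim h1 h2
  refine ⟨hav (.lb j t) _ ?_ ?_, hav (.lb j t) _ ?_ ?_, hav (.la i s) _ ?_ ?_,
    hav (.la i s) _ ?_ ?_, F.meet (.la i s) (.lb j t) (by simp), ?_⟩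
  all_goals try simp [BaseEdge.src, BaseEdge.tgt]
  apply triangle_parity (F.la i s) (F.hm i s).symm (F.hu i s) (F.lb j t) (F.hm j t) (F.hv j t).symm
  case ek => exact cross_eq_zero_of_disjoint _ _ (F.disj (.la i s) (.hm j t) (by decide +revert) rfl)
  case el =>
    simp only [cross_symm_right]
    exact cross_eq_zero_of_disjoint _ _ (F.disj (.la i s) (.hv j t) (by decide +revert) rfl)
  case gf =>
    simp only [cross_symm_left]
    exact cross_eq_zero_of_disjoint _ _ (F.disj (.hm i s) (.lb j t) (by decide +revert) rfl)
  case gk =>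
    simp only [cross_symm_left]
    exact cross_eq_zero_of_disjoint _ _ (F.disj (.hm i s) (.hm j t) (by decide +revert) rfl)
  case gl =>
    simp only [cross_symm_left, cross_symm_right]
    exact cross_eq_zero_of_disjoint _ _ (F.disj (.hm i s) (.hv j t) (by decide +revert) rfl)
  case hf => exact cross_eq_zero_of_disjoint _ _ (F.disj (.hu i s) (.lb j t) (by decide +revert) rfl)
  case hk => exact cross_eq_zero_of_disjoint _ _ (F.disj (.hu i s) (.hm j t) (by decide +revert) rfl)
  case hl =>
    simp only [cross_symm_right]
    exact cross_eq_zero_of_disjoint _ _ (F.disj (.hu i s) (.hv j t) (by decide +revert) rfl)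
  all_goals
    apply F.pt_ne
    decide +revert

/-- The heavy path from one pole to the other along a side. -/
def side (i s : Bool) : Path (F.pt .u) (F.pt .v) := ((F.hu i s).trans (F.hm i s)).trans (F.hv i s)

theorem range_side (i s : Bool) : range (F.side i s) =
    range (F.arc (.hu i s)) ∪ range (F.arc (.hm i s)) ∪ range (F.arc (.hv i s)) := by
  rw [side, Path.trans_range, Path.trans_range]; rfl

theorem cross_la_lb (i s : Bool) : cross (F.la i s) (F.lb i s) = 1 := by
  have hs : ∀ e : BaseEdge, e.Indep (.hu (!i) false) → e.Indep (.hm (!i) false) →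
      e.Indep (.hv (!i) false) → Disjoint (range (F.arc e)) (range (F.side (!i) false)) := by
    intro e h1 h2 h3
    rw [range_side, disjoint_union_right, disjoint_union_right]
    exact ⟨⟨F.disj _ _ h1 (by simp [light]), F.disj _ _ h2 (by simp [light])⟩,
      F.disj _ _ h3 (by simp [light])⟩
  have key := k4_parity (F.lb i s).symm (F.rb i s) (F.hv i !s) (F.hm i !s).symm
    (F.hm i s) (F.ra i s).symm (F.side (!i) false).symm (F.hu i !s).symm ?_ ?_ ?_ ?_ ?_ ?_ ?_
    ?_ ?_ ?_ ?_ ?_ ?_ ?_ ?_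
  · have hq := quad_parity (F.lb i s).symm (F.hv i !s) (F.hm i !s).symm (F.rb i s) (F.la i s)
    have h1 : cross (F.hv i !s) (F.la i s) = 0 :=
      cross_eq_zero_of_disjoint _ _ (F.disj (.hv i !s) (.la i s) (by simp [Indep, src, tgt]) rfl)
    have h2 : cross (F.hm i !s) (F.la i s) = 0 :=
      cross_eq_zero_of_disjoint _ _ (F.disj (.hm i !s) (.la i s) (by simp [Indep, src, tgt]) rfl)
    have h3 : cross (F.rb i s) (F.la i s) = 0 :=
      cross_eq_zero_of_disjoint _ _ (by
        rw [range_rb]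
        exact F.disj (.rb i) (.la i s) (by simp [Indep, src, tgt]) rfl)
    have h4 : cross (F.lb i s) (F.la i s) = cross (F.la i s) (F.lb i s) := by
      refine cross_comm _ _ (fun h => ?_) fun h => ?_
      · rcases F.avoid (.la i s) _ h with h | h <;> cases h
      · rcases F.avoid (.la i s) _ h with h | h <;> cases h
    simp only [cross_symm_left, h1, h2, h3, h4] at hq
    grind
  · simp only [List.nodup_cons, List.mem_cons, List.not_mem_nil, or_false, not_or,
      F.pt_inj.eq_iff]
    simp
  all_goals
    try simp only [cross_symm_left, cross_symm_right]
    apply cross_eq_zero_of_disjoint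
    try simp only [range_ra, range_rb]
  · exact F.disj (.lb i s) (.hm i !s) (by simp [Indep, src, tgt]) rfl
  · exact F.disj (.rb i) (.hv i !s) (by simp [Indep, src, tgt]) rfl
  · exact F.disj (.hm i s) (.hv i !s) (by simp [Indep, src, tgt]) rfl
  · exact F.disj (.hm i s) (.hm i !s) (by simp [Indep, src, tgt]) rfl
  · exact hs (.hm i s) (by simp [Indep, src, tgt]) (by simp [Indep, src, tgt]) (by simp [Indep, src, tgt])
  · exact F.disj (.hm i s) (.hu i !s) (by simp [Indep, src, tgt]) rfl
  · exact F.disj (.ra i) (.lb i s) (by simp [Indep, src, tgt]) rfl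
  · exact F.disj (.ra i) (.rb i) (by simp [Indep, src, tgt]) rfl
  · exact hs (.ra i) (by simp [Indep, src, tgt]) (by simp [Indep, src, tgt]) (by simp [Indep, src, tgt])
  · exact F.disj (.ra i) (.hu i !s) (by simp [Indep, src, tgt]) rfl
  · exact (hs (.rb i) (by simp [Indep, src, tgt]) (by simp [Indep, src, tgt]) (by simp [Indep, src, tgt])).symm
  · exact (hs (.hm i !s) (by simp [Indep, src, tgt]) (by simp [Indep, src, tgt])
      (by simp [Indep, src, tgt])).symm
  · exact F.disj (.hu i !s) (.lb i s) (by simp [Indep, src, tgt]) rfl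
  · exact F.disj (.hu i !s) (.hv i !s) (by simp [Indep, src, tgt]) rfl

end Frame

/-- A frame with its light edges cut where the two light edges of a side cross. -/
structure CutFrame extends Frame where
  x : Bool → Bool → ℂ
  la₁ : ∀ i s, Path (pt .u) (x i s)
  la₂ : ∀ i s, Path (x i s) (pt (.a i s))
  lb₁ : ∀ i s, Path (pt .v) (x i s)
  lb₂ : ∀ i s, Path (x i s) (pt (.b i s))
  split_la : ∀ i s, IsSplit (toFrame.la i s) (la₁ i s) (la₂ i s)
  split_lb : ∀ i s, IsSplit (toFrame.lb i s) (lb₁ i s) (lb₂ i s)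

theorem Frame.exists_cutFrame (F : Frame) : ∃ K : CutFrame, K.toFrame = F := by
  have h : ∀ i s, ∃ x, x ∈ range (F.la i s) ∧ x ∈ range (F.lb i s) := by
    intro i s
    by_contra! h
    have := cross_eq_zero_of_disjoint _ _ (Set.disjoint_left.2 h)
    rw [F.cross_la_lb] at this
    exact one_ne_zero this
  choose x hxa hxb using h
  choose la₁ la₂ ha using fun i s => exists_isSplit (F.la i s) (F.arc_inj _) (hxa i s)
  choose lb₁ lb₂ hb using fun i s => exists_isSplit (F.lb i s) (F.arc_inj _) (hxb i s)
  exact ⟨⟨F, x, la₁, la₂, lb₁, lb₂, ha, hb⟩, rfl⟩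

theorem IsSplit.left_subset {a b x : ℂ} {γ : Path a b} {γ₁ : Path a x} {γ₂ : Path x b}
    (h : IsSplit γ γ₁ γ₂) : range γ₁ ⊆ range γ := h.range_eq ▸ subset_union_left

theorem IsSplit.right_subset {a b x : ℂ} {γ : Path a b} {γ₁ : Path a x} {γ₂ : Path x b}
    (h : IsSplit γ γ₁ γ₂) : range γ₂ ⊆ range γ := h.range_eq ▸ subset_union_right

theorem IsSplit.source_notMem {a b x : ℂ} {γ : Path a b} {γ₁ : Path a x} {γ₂ : Path x b}
    (h : IsSplit γ γ₁ γ₂) (hx : a ≠ x) : a ∉ range γ₂ := fun h' =>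
  hx (h.inter_eq ▸ ⟨⟨0, γ₁.source⟩, h'⟩ : a ∈ ({x} : Set ℂ))

theorem IsSplit.target_notMem {a b x : ℂ} {γ : Path a b} {γ₁ : Path a x} {γ₂ : Path x b}
    (h : IsSplit γ γ₁ γ₂) (hx : b ≠ x) : b ∉ range γ₁ := fun h' =>
  hx (h.inter_eq ▸ ⟨h', ⟨1, γ₂.target⟩⟩ : b ∈ ({x} : Set ℂ))

namespace CutFrame

variable (K : CutFrame)

theorem x_mem_la (i s : Bool) : K.x i s ∈ range (K.la i s) :=
  (K.split_la i s).left_subset ⟨1, Path.target _⟩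

theorem x_mem_lb (i s : Bool) : K.x i s ∈ range (K.lb i s) :=
  (K.split_lb i s).left_subset ⟨1, Path.target _⟩

theorem pt_ne_x (w : BaseVertex) (i s : Bool) : K.pt w ≠ K.x i s := by
  intro h
  have h1 := K.avoid (.la i s) w (h ▸ K.x_mem_la i s)
  have h2 := K.avoid (.lb i s) w (h ▸ K.x_mem_lb i s)
  rcases h1 with rfl | rfl <;> simp [src, tgt] at h2

theorem x_notMem {i s : Bool} {e : BaseEdge} (ha : e ≠ .la i s) (hb : e ≠ .lb i s) :
    K.x i s ∉ range (K.arc e) := by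
  intro h
  have key : ∀ f w, (f = .la i s ∨ f = .lb i s) → (w = e.src ∨ w = e.tgt) →
      (w = src f ∨ w = tgt f) → False := by
    rintro f w (rfl | rfl) h1 h2
    · exact K.pt_ne_x w i s (K.adj e _ w ha h1 h2 ⟨h, K.x_mem_la i s⟩).symm
    · exact K.pt_ne_x w i s (K.adj e _ w hb h1 h2 ⟨h, K.x_mem_lb i s⟩).symm
  have hlight : e.light = true ∨ e.light = false := by cases e.light <;> simp
  rcases hlight with hl | hl
  · cases e
    case la j t => exact key _ .u (Or.inl rfl) (Or.inl rfl) (Or.inl rfl)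
    case lb j t => exact key _ .v (Or.inr rfl) (Or.inl rfl) (Or.inl rfl)
    all_goals simp [light] at hl
  · by_cases hi : e.Indep (.la i s)
    · exact Set.disjoint_left.1 (K.disj e _ hi (by simp [hl])) h (K.x_mem_la i s)
    · simp only [Indep, not_and_or, not_not] at hi
      rcases hi with hi | hi | hi | hi
      · exact key _ _ (Or.inl rfl) (Or.inl rfl) (Or.inl hi)
      · exact key _ _ (Or.inl rfl) (Or.inl rfl) (Or.inr hi)
      · exact key _ _ (Or.inl rfl) (Or.inr rfl) (Or.inl hi)
      · exact key _ _ (Or.inl rfl) (Or.inr rfl) (Or.inr hi)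

theorem la₁_subset (i s : Bool) : range (K.la₁ i s) ⊆ range (K.arc (.la i s)) :=
  (K.split_la i s).left_subset

theorem lb₁_subset (i s : Bool) : range (K.lb₁ i s) ⊆ range (K.arc (.lb i s)) :=
  (K.split_lb i s).left_subset

theorem lb₂_subset (i s : Bool) : range (K.lb₂ i s) ⊆ range (K.arc (.lb i s)) :=
  (K.split_lb i s).right_subset

theorem uncrossed_la_lb₁ {i s j t : Bool} (h : (i, s) ≠ (j, t)) :
    Uncrossed (K.la i s) (K.lb₁ j t) :=
  ((K.split_lb j t).uncrossed_fst (K.uncrossed_la_lb h).swap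
    (K.x_notMem (e := .la i s) (by simpa using h) (by simp))).swap

theorem uncrossed_la_lb₂ {i s j t : Bool} (h : (i, s) ≠ (j, t)) :
    Uncrossed (K.la i s) (K.lb₂ j t) :=
  ((K.split_lb j t).uncrossed_snd (K.uncrossed_la_lb h).swap
    (K.x_notMem (e := .la i s) (by simpa using h) (by simp))).swap

theorem uncrossed_la₁_lb {i s j t : Bool} (h : (i, s) ≠ (j, t)) :
    Uncrossed (K.la₁ i s) (K.lb j t) :=
  (K.split_la i s).uncrossed_fst (K.uncrossed_la_lb h)
    (K.x_notMem (e := .lb j t) (by simp) (by simpa using h.symm))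

theorem uncrossed_la₁_lb₁ {i s j t : Bool} (h : (i, s) ≠ (j, t)) :
    Uncrossed (K.la₁ i s) (K.lb₁ j t) :=
  (K.split_la i s).uncrossed_fst (K.uncrossed_la_lb₁ h)
    fun h' => K.x_notMem (e := .lb j t) (by simp) (by simpa using h.symm) (K.lb₁_subset _ _ h')

theorem uncrossed_la₁_lb₂ {i s j t : Bool} (h : (i, s) ≠ (j, t)) :
    Uncrossed (K.la₁ i s) (K.lb₂ j t) :=
  (K.split_la i s).uncrossed_fst (K.uncrossed_la_lb₂ h)
    fun h' => K.x_notMem (e := .lb j t) (by simp) (by simpa using h.symm) (K.lb₂_subset _ _ h')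

theorem v_notMem_lb₂ (i s : Bool) : K.pt .v ∉ range (K.lb₂ i s) :=
  (K.split_lb i s).source_notMem (K.pt_ne_x _ _ _)

theorem b_notMem_lb₁ (i s : Bool) : K.pt (.b i s) ∉ range (K.lb₁ i s) :=
  (K.split_lb i s).target_notMem (K.pt_ne_x _ _ _)

theorem a_notMem_la₁ (i s : Bool) : K.pt (.a i s) ∉ range (K.la₁ i s) :=
  (K.split_la i s).target_notMem (K.pt_ne_x _ _ _)

theorem disjoint_lb₂_lb₁ {i s j t : Bool} (h : (i, s) ≠ (j, t)) :
    Disjoint (range (K.lb₂ i s)) (range (K.lb₁ j t)) := by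
  rw [Set.disjoint_left]
  intro p hp hp'
  have : p = K.pt .v := K.adj (.lb i s) (.lb j t) .v (by simpa using h) (Or.inl rfl) (Or.inl rfl)
    ⟨K.lb₂_subset _ _ hp, K.lb₁_subset _ _ hp'⟩
  exact K.v_notMem_lb₂ i s (this ▸ hp)

/-- The closed curve through both poles bounding copy `i`. -/
def loop (i : Bool) : Path (K.pt .u) (K.pt .u) :=
  (((K.la₁ i false).trans (K.lb₁ i false).symm).trans (K.lb₁ i true)).trans (K.la₁ i true).symm

theorem mem_loop {i : Bool} {z : ℂ} : z ∈ range (K.loop i) ↔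
    ((z ∈ range (K.la₁ i false) ∨ z ∈ range (K.lb₁ i false)) ∨ z ∈ range (K.lb₁ i true)) ∨
      z ∈ range (K.la₁ i true) := by
  simp only [loop, Path.trans_range, Path.symm_range, mem_union]

theorem mem_loop' {i : Bool} {z : ℂ} : z ∈ range (K.loop i) ↔
    ∃ s, z ∈ range (K.la₁ i s) ∨ z ∈ range (K.lb₁ i s) := by
  rw [mem_loop, Bool.exists_bool]; tauto

theorem turn_loop {i : Bool} {z : ℂ} (hz : z ∉ range (K.loop i)) : turn z (K.loop i) =
    turn z (K.la₁ i false) + turn z (K.lb₁ i false) + turn z (K.lb₁ i true) +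
      turn z (K.la₁ i true) := by
  simp only [mem_loop, not_or] at hz
  obtain ⟨⟨⟨h1, h2⟩, h3⟩, h4⟩ := hz
  rw [loop, turn_trans, turn_trans, turn_trans, turn_symm, turn_symm]
  all_goals simp [Path.trans_range, Path.symm_range, h1, h2, h3, h4]

theorem pt_notMem_loop {i : Bool} {w : BaseVertex} (hu : w ≠ .u) (hv : w ≠ .v) :
    K.pt w ∉ range (K.loop i) := by
  rw [mem_loop']
  rintro ⟨s, h | h⟩
  · rcases K.avoid (.la i s) w (K.la₁_subset _ _ h) with rfl | rfl
    · exact hu rfl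
    · exact K.a_notMem_la₁ i s h
  · rcases K.avoid (.lb i s) w (K.lb₁_subset _ _ h) with rfl | rfl
    · exact hv rfl
    · exact K.b_notMem_lb₁ i s h

theorem cross_of_disj {e : BaseEdge} {f : BaseEdge} {a b : ℂ} {γ : Path a b}
    (hγ : range γ ⊆ range (K.arc f)) (h : e.Indep f) (he : e.light = false) :
    Uncrossed (K.arc e) γ :=
  .of_disjoint ((K.disj e f h (by simp [he])).mono_right hγ)

theorem disjoint_hv_lb₂ (i s j t : Bool) :
    Disjoint (range (K.hv i s)) (range (K.lb₂ j t)) := by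
  rw [Set.disjoint_left]
  intro p hp hp'
  have : p = K.pt .v := K.adj (.hv i s) (.lb j t) .v (by simp) (Or.inr rfl) (Or.inl rfl)
    ⟨hp, K.lb₂_subset _ _ hp'⟩
  exact K.v_notMem_lb₂ j t (this ▸ hp')

theorem turn_loop_add (i : Bool) : turn (K.pt (.b i false)) (K.loop i) +
    turn (K.pt (.b (!i) false)) (K.loop i) = 1 := by
  rw [K.turn_loop (K.pt_notMem_loop (by simp) (by simp)),
    K.turn_loop (K.pt_notMem_loop (by simp) (by simp))]
  have hrb : ∀ s, Disjoint (range (K.rb i true)) (range (K.la₁ i s)) := fun s =>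
    K.range_rb i true ▸
      (K.disj (.rb i) (.la i s) (by simp [Indep, src, tgt]) rfl).mono_right (K.la₁_subset _ _)
  have hrb' : Disjoint (range (K.rb i true)) (range (K.lb₁ i false)) := by
    rw [Frame.range_rb, Set.disjoint_left]
    intro p hp hp'
    have : p = K.pt (.b i false) := K.adj (.rb i) (.lb i false) _ (by simp) (Or.inl rfl)
      (Or.inr rfl) ⟨hp, K.lb₁_subset _ _ hp'⟩
    exact K.b_notMem_lb₁ i false (this ▸ hp')
  have hR : ∀ e : BaseEdge, e.Indep (.rb i) →
      Disjoint (range (K.arc e)) (range (K.rb i true)) := fun e he =>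
    (K.range_rb i true).symm ▸ K.disj e (.rb i) he (by simp [light])
  have key := k4_parity (K.la₁ i false) (K.la₁ i true) (K.lb₁ i false) (K.lb₁ i true)
    (K.hu (!i) false) ((K.hv (!i) false).symm.trans (K.hm (!i) false).symm)
    (K.lb₂ i false) ((K.lb₂ i true).trans (K.rb i true)) ?_
    (K.uncrossed_la₁_lb₁ (by simp)).cross_eq (K.uncrossed_la₁_lb₁ (by simp)).cross_eq
    (K.cross_of_disj (e := .hu (!i) false) (K.lb₁_subset _ _) (by simp [Indep, src, tgt])
      rfl).cross_eq
    (K.cross_of_disj (e := .hu (!i) false) (K.lb₁_subset _ _) (by simp [Indep, src, tgt])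
      rfl).cross_eq
    (K.cross_of_disj (e := .hu (!i) false) (K.lb₂_subset _ _) (by simp [Indep, src, tgt])
      rfl).cross_eq ?_ ?_ ?_ ?_ ?_
    (K.uncrossed_la₁_lb₂ (by simp)).swap.cross_eq
    (Uncrossed.of_disjoint (K.disjoint_lb₂_lb₁ (by simp))).cross_eq ?_ ?_
  · linear_combination key
  · simp only [List.nodup_cons, List.mem_cons, List.not_mem_nil, or_false, not_or,
      K.pt_inj.eq_iff, K.pt_ne_x, (K.pt_ne_x _ _ _).symm]
    simp only [reduceCtorEq, not_false_eq_true, List.nodup_nil, and_true, true_and]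
    refine ⟨fun h => ?_, by simp⟩
    exact K.x_notMem (e := .la i true) (i := i) (s := false) (by simp) (by simp)
      (h ▸ K.x_mem_la i true)
  · refine cross_eq_zero_of_disjoint _ _ ?_
    rw [Path.trans_range, disjoint_union_right]
    exact ⟨(K.disj (.hu (!i) false) (.lb i true) (by simp [Indep, src, tgt]) rfl).mono_right
      (K.lb₂_subset _ _), hR (.hu (!i) false) (by simp [Indep, src, tgt])⟩
  iterate 2
    exact (K.cross_of_disj (e := .hv (!i) false) (K.la₁_subset _ _) (by simp [Indep, src, tgt])
      rfl).symm_left.cross_trans (K.cross_of_disj (e := .hm (!i) false) (K.la₁_subset _ _)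
      (by simp [Indep, src, tgt]) rfl).symm_left
  · exact (Uncrossed.of_disjoint (K.disjoint_hv_lb₂ _ _ _ _)).symm_left.cross_trans (K.cross_of_disj (e := .hm (!i) false) (K.lb₂_subset _ _)
      (by simp [Indep, src, tgt]) rfl).symm_left
  · refine cross_eq_zero_of_disjoint _ _ ?_
    simp only [Path.trans_range, Path.symm_range, disjoint_union_right, disjoint_union_left]
    exact ⟨⟨K.disjoint_hv_lb₂ _ _ _ _, (K.disj (.hm (!i) false) (.lb i true) (by simp [Indep, src, tgt])
      rfl).mono_right (K.lb₂_subset _ _)⟩,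
      hR (.hv (!i) false) (by simp [Indep, src, tgt]),
      hR (.hm (!i) false) (by simp [Indep, src, tgt])⟩
  · exact (K.uncrossed_la₁_lb₂ (by simp)).swap.cross_trans (.of_disjoint (hrb _))
  · exact (Uncrossed.of_disjoint (K.disjoint_lb₂_lb₁ (by simp))).cross_trans (.of_disjoint hrb')

end CutFrame

namespace CutFrame

variable (K : CutFrame)

theorem source_mem_loop {i : Bool} : K.pt .u ∈ range (K.loop i) := ⟨0, Path.source _⟩

theorem pole_mem_loop {i : Bool} : K.pt .v ∈ range (K.loop i) :=
  K.mem_loop'.2 ⟨false, Or.inr ⟨0, Path.source _⟩⟩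

theorem disjoint_loop {e : BaseEdge} (he : e.light = false)
    (hs : e.src ≠ .u ∧ e.src ≠ .v) (ht : e.tgt ≠ .u ∧ e.tgt ≠ .v) (j : Bool) :
    Disjoint (range (K.loop j)) (range (K.arc e)) := by
  have key : ∀ f p, (∃ i s, f = .la i s ∨ f = .lb i s) → p ∈ range (K.arc e) →
      p ∈ range (K.arc f) → p ∈ range (K.loop j) → False := by
    intro f p hf hpe hpf hp
    have hef : e ≠ f := by rintro rfl; rcases hf with ⟨i, s, rfl | rfl⟩ <;> simp [light] at he
    have hpt : ∀ x, x ≠ .u → x ≠ .v → (x = e.src ∨ x = e.tgt) → (x = f.src ∨ x = f.tgt) →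
        False := fun x h1 h2 h3 h4 =>
      K.pt_notMem_loop h1 h2 (K.adj e f x hef h3 h4 ⟨hpe, hpf⟩ ▸ hp)
    by_cases hi : e.Indep f
    · exact Set.disjoint_left.1 (K.disj e f hi (by simp [he])) hpe hpf
    · simp only [Indep, not_and_or, not_not] at hi
      rcases hi with hi | hi | hi | hi
      · exact hpt _ hs.1 hs.2 (Or.inl rfl) (Or.inl hi)
      · exact hpt _ hs.1 hs.2 (Or.inl rfl) (Or.inr hi)
      · exact hpt _ ht.1 ht.2 (Or.inr rfl) (Or.inl hi)
      · exact hpt _ ht.1 ht.2 (Or.inr rfl) (Or.inr hi)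
  rw [Set.disjoint_left]
  intro p hp hpe
  rcases K.mem_loop'.1 hp with ⟨s, h | h⟩
  · exact key (.la j s) p ⟨_, _, Or.inl rfl⟩ hpe (K.la₁_subset _ _ h) hp
  · exact key (.lb j s) p ⟨_, _, Or.inr rfl⟩ hpe (K.lb₁_subset _ _ h) hp

theorem turn_b (i s j : Bool) :
    turn (K.pt (.b i s)) (K.loop j) = turn (K.pt (.b i false)) (K.loop j) := by
  cases s
  · rfl
  · exact (turn_loop_eq_of_disjoint _ (K.arc (.rb i)) (K.disjoint_loop (e := .rb i) rfl
      (by simp [src]) (by simp [tgt]) j)).symm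

theorem turn_a (i s j : Bool) :
    turn (K.pt (.a i s)) (K.loop j) = turn (K.pt (.b i false)) (K.loop j) := by
  rw [← K.turn_b i s j]
  exact (turn_loop_eq_of_disjoint _ (K.arc (.hm i s)) (K.disjoint_loop (e := .hm i s) rfl
      (by simp [src]) (by simp [tgt]) j)).symm

theorem turn_loop_eq {j : Bool} {z w : ℂ} (δ : Path z w) (hz : z ∉ range (K.loop j))
    (hw : w ∉ range (K.loop j)) (ha : ∀ s, cross (K.la₁ j s) δ = 0)
    (hb : ∀ s, cross (K.lb₁ j s) δ = 0) : turn z (K.loop j) = turn w (K.loop j) := by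
  have := quad_parity (K.la₁ j false) (K.lb₁ j false) (K.lb₁ j true) (K.la₁ j true) δ
  rw [ha, hb, hb, ha, ← K.turn_loop hz, ← K.turn_loop hw] at this
  grind

theorem turn_mem_loop {i j : Bool} (hij : i ≠ j)
    (h : turn (K.pt (.b i false)) (K.loop j) = 1) {z : ℂ} (hz : z ∈ range (K.loop i))
    (hzj : z ∉ range (K.loop j)) : turn z (K.loop j) = 1 := by
  have hne : ∀ s t : Bool, (i, s) ≠ (j, t) := fun s t => by simp [hij]
  have hla₁ : ∀ t, z ∉ range (K.la₁ j t) := fun t ht => hzj (K.mem_loop'.2 ⟨t, Or.inl ht⟩)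
  have hlb₁ : ∀ t, z ∉ range (K.lb₁ j t) := fun t ht => hzj (K.mem_loop'.2 ⟨t, Or.inr ht⟩)
  rcases K.mem_loop'.1 hz with ⟨s, h' | h'⟩
  · obtain ⟨e₁, e₂, he⟩ := exists_isSplit (K.la i s) (K.arc_inj _) (K.la₁_subset i s h')
    rw [K.turn_loop_eq e₂ hzj (K.pt_notMem_loop (by simp) (by simp)), K.turn_a, h]
    · refine fun t => cross_eq_zero_of_disjoint _ _ (Set.disjoint_left.2 fun p hp hp' => ?_)
      have : p = K.pt .u := K.adj (.la i s) (.la j t) .u (by simp [hij]) (Or.inl rfl) (Or.inl rfl)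
        ⟨he.right_subset hp', K.la₁_subset _ _ hp⟩
      exact he.source_notMem (fun hu => hzj (hu ▸ K.source_mem_loop)) (this ▸ hp')
    · exact fun t => (he.uncrossed_snd (K.uncrossed_la_lb₁ (hne s t)) (hlb₁ t)).swap.cross_eq
  · obtain ⟨e₁, e₂, he⟩ := exists_isSplit (K.lb i s) (K.arc_inj _) (K.lb₁_subset i s h')
    rw [K.turn_loop_eq e₂ hzj (K.pt_notMem_loop (by simp) (by simp)), K.turn_b, h]
    · exact fun t => (he.uncrossed_snd (K.uncrossed_la₁_lb (hne s t).symm).swap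
        (hla₁ t)).swap.cross_eq
    · refine fun t => cross_eq_zero_of_disjoint _ _ (Set.disjoint_left.2 fun p hp hp' => ?_)
      have : p = K.pt .v := K.adj (.lb i s) (.lb j t) .v (by simp [hij]) (Or.inl rfl) (Or.inl rfl)
        ⟨he.right_subset hp', K.lb₁_subset _ _ hp⟩
      exact he.source_notMem (fun hu => hzj (hu ▸ K.pole_mem_loop)) (this ▸ hp')

theorem exists_turn_eq_one : ∃ i, ∀ s, turn (K.pt (.a i s)) (K.loop i) = 1 ∧
    turn (K.pt (.b i s)) (K.loop i) = 1 := by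
  suffices ∃ i, turn (K.pt (.b i false)) (K.loop i) = 1 by
    obtain ⟨i, hi⟩ := this
    exact ⟨i, fun s => ⟨by rw [K.turn_a, hi], by rw [K.turn_b, hi]⟩⟩
  by_contra! h
  have h0 : ∀ i, turn (K.pt (.b (!i) false)) (K.loop i) = 1 := by
    intro i
    have h1 := K.turn_loop_add i
    have h2 : ∀ w : ZMod 2, w ≠ 1 → w = 0 := by decide
    rwa [h2 _ (h i), zero_add] at h1
  refine not_mutually_inside (K.loop false) (K.loop true) ?_ ?_
    (fun z hz hz' => K.turn_mem_loop (by simp) (h0 true) hz hz')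
    (fun z hz hz' => K.turn_mem_loop (by simp) (h0 false) hz hz')
  · have hsub : range (K.loop false) ∩ range (K.loop true) ⊆
        ⋃ e : BaseEdge, ⋃ f : BaseEdge, ⋃ _ : e ≠ f, range (K.arc e) ∩ range (K.arc f) := by
      rintro p ⟨hp, hp'⟩
      simp only [mem_iUnion]
      rcases K.mem_loop'.1 hp with ⟨s, h | h⟩ <;> rcases K.mem_loop'.1 hp' with ⟨t, h' | h'⟩
      · exact ⟨.la false s, .la true t, by simp, K.la₁_subset _ _ h, K.la₁_subset _ _ h'⟩
      · exact ⟨.la false s, .lb true t, by simp, K.la₁_subset _ _ h, K.lb₁_subset _ _ h'⟩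
      · exact ⟨.lb false s, .la true t, by simp, K.lb₁_subset _ _ h, K.la₁_subset _ _ h'⟩
      · exact ⟨.lb false s, .lb true t, by simp, K.lb₁_subset _ _ h, K.lb₁_subset _ _ h'⟩
    refine Countable.mono hsub ?_
    exact countable_iUnion fun e => countable_iUnion fun f => countable_iUnion fun hef =>
      (K.meet e f hef).countable
  · refine ⟨K.x false false, K.mem_loop'.2 ⟨false, Or.inl ⟨1, Path.target _⟩⟩, fun hx => ?_⟩
    rcases K.mem_loop'.1 hx with ⟨t, h' | h'⟩
    · exact K.x_notMem (e := .la true t) (by simp) (by simp) (K.la₁_subset _ _ h')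
    · exact K.x_notMem (e := .lb true t) (by simp) (by simp) (K.lb₁_subset _ _ h')

end CutFrame

theorem StrictMono.exists_arc_complement {X : Type*} {f : AddCircle (1 : ℝ) → X}
    [TopologicalSpace X] (hf : Continuous f) (hinj : Function.Injective f)
    {φ : C(unitInterval, ℝ)} (hφ : StrictMono φ) (hφ' : Function.Injective fun t => f (φ t)) :
    ∃ G : C(unitInterval, X), G 0 = f (φ 1) ∧ G 1 = f (φ 0) ∧
      range f ⊆ range (fun t => f (φ t)) ∪ range G ∧ range G ⊆ range f ∧
      ∀ t, G t ∈ range (fun t => f (φ t)) → t = 0 ∨ t = 1 := by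
  have hsub : Icc (φ 0) (φ 1) ⊆ range φ := by
    intro y hy
    obtain ⟨t, -, ht⟩ := intermediate_value_Icc (f := φ) (zero_le_one : (0 : unitInterval) ≤ 1)
      φ.continuous.continuousOn hy
    exact ⟨t, ht⟩
  have h01 : φ 0 < φ 1 := hφ zero_lt_one
  have hlt : φ 1 < φ 0 + 1 := by
    by_contra! h
    obtain ⟨t, ht⟩ := hsub ⟨by linarith, h⟩
    have : t = 0 := hφ' (by
      change f (φ t) = f (φ 0)
      rw [ht, AddCircle.coe_add, AddCircle.coe_period, add_zero])
    rw [this] at ht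
    linarith
  have hG : Continuous fun t : unitInterval =>
      f ((φ 1 + t * (φ 0 + 1 - φ 1) : ℝ) : AddCircle (1 : ℝ)) :=
    hf.comp ((AddCircle.continuous_mk' 1).comp (by fun_prop))
  refine ⟨⟨_, hG⟩, by simp, ?_, ?_, ?_, ?_⟩
  · simp only [ContinuousMap.coe_mk, Icc.coe_one]
    congr 1
    rw [show φ 1 + 1 * (φ 0 + 1 - φ 1) = φ 0 + 1 by ring, AddCircle.coe_add,
      AddCircle.coe_period, add_zero]
  · rintro _ ⟨y, rfl⟩
    obtain ⟨x, hx, rfl⟩ : y ∈ ((↑) : ℝ → AddCircle (1 : ℝ)) '' Ico (φ 0) (φ 0 + 1) := by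
      rw [AddCircle.coe_image_Ico_eq]; trivial
    rcases le_total x (φ 1) with h | h
    · obtain ⟨t, rfl⟩ := hsub ⟨hx.1, h⟩
      exact Or.inl ⟨t, rfl⟩
    · have hpos : 0 < φ 0 + 1 - φ 1 := by linarith
      refine Or.inr ⟨⟨(x - φ 1) / (φ 0 + 1 - φ 1), by
        rw [mem_Icc, div_le_one hpos]
        exact ⟨div_nonneg (by linarith) hpos.le, by linarith [hx.2]⟩⟩, ?_⟩
      simp only [ContinuousMap.coe_mk]
      rw [div_mul_cancel₀ _ hpos.ne', add_sub_cancel]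
  · rintro _ ⟨t, rfl⟩
    exact ⟨_, rfl⟩
  · rintro t ⟨s, hs⟩
    have hpos : 0 < φ 0 + 1 - φ 1 := by linarith
    have h1 : φ 0 ≤ φ s := hφ.monotone s.2.1
    have h2 : φ s ≤ φ 1 := hφ.monotone s.2.2
    have ht0 := t.2.1
    have ht1 := t.2.2
    obtain ⟨n, hn⟩ := (AddCircle.coe_eq_zero_iff (1 : ℝ)).1
      ((AddCircle.coe_sub 1 _ _).trans (sub_eq_zero.2 (hinj hs).symm))
    simp only [zsmul_eq_mul, mul_one] at hn
    have hn0 : (-1 : ℝ) < n := by nlinarith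
    have hn1 : (n : ℝ) < 2 := by nlinarith
    have hn0' : -1 < n := by exact_mod_cast hn0
    have hn1' : n < 2 := by exact_mod_cast hn1
    interval_cases n
    · left
      have : (t : ℝ) * (φ 0 + 1 - φ 1) = 0 := le_antisymm (by push_cast at hn; linarith)
        (mul_nonneg ht0 hpos.le)
      exact Subtype.ext ((mul_eq_zero.1 this).resolve_right hpos.ne')
    · right
      have : (1 - (t : ℝ)) * (φ 0 + 1 - φ 1) = 0 := le_antisymm (by push_cast at hn; linarith)
        (mul_nonneg (by linarith) hpos.le)
      have := (mul_eq_zero.1 this).resolve_right hpos.ne'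
      exact Subtype.ext (by rw [Icc.coe_one]; linarith)

/-- An arc on a simple closed curve has a complementary arc. -/
theorem exists_arc_complement {X : Type*} [TopologicalSpace X] [T2Space X]
    {f : AddCircle (1 : ℝ) → X} (hf : Continuous f) (hinj : Function.Injective f)
    (e : C(unitInterval, X)) (he : Function.Injective e) (hef : range e ⊆ range f) :
    ∃ G : C(unitInterval, X), G 0 = e 1 ∧ G 1 = e 0 ∧ range f ⊆ range e ∪ range G ∧
      range G ⊆ range f ∧ ∀ t, G t ∈ range e → t = 0 ∨ t = 1 := by
  have hemb : Topology.IsEmbedding f := (hf.isClosedEmbedding hinj).isEmbedding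
  choose ψ hψ using fun t => hef ⟨t, rfl⟩
  have hψc : Continuous ψ := hemb.continuous_iff.2 (by
    rw [show f ∘ ψ = e from funext hψ]; exact e.continuous)
  obtain ⟨y, hy⟩ := QuotientAddGroup.mk_surjective (ψ 0)
  obtain ⟨φ, hφ, -⟩ := (AddCircle.isCoveringMap_coe (1 : ℝ)).exists_path_lifts ⟨ψ, hψc⟩ y hy.symm
  have hφe : ∀ t, f (φ t) = e t := fun t => by rw [← hψ]; exact congrArg f (congrFun hφ t)
  have hφi : Function.Injective φ := fun s t h => he (by rw [← hφe, ← hφe, h])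
  have hfe : (fun t => f (φ t)) = e := funext hφe
  rcases φ.continuous.strictMono_of_inj hφi with hm | hm
  · obtain ⟨G, h0, h1, h2, h3, h4⟩ := hm.exists_arc_complement hf hinj (hfe ▸ he)
    rw [hfe] at h2 h4
    exact ⟨G, h0.trans (hφe 1), h1.trans (hφe 0), h2, h3, h4⟩
  · have hneg : ∀ t, f (-((-φ) t : ℝ)) = e t := fun t => by simp [hφe]
    have hfe : (fun t => (fun x => f (-x)) ((-φ) t : ℝ)) = e := funext hneg
    have hr : range (fun x => f (-x)) = range f := (neg_surjective).range_comp f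
    obtain ⟨G, h0, h1, h2, h3, h4⟩ := StrictMono.exists_arc_complement (f := fun x => f (-x))
      (hf.comp continuous_neg) (hinj.comp neg_injective) (φ := -φ) (fun s t h => neg_lt_neg (hm h))
      (by rw [hfe]; exact he)
    rw [hfe] at h2 h4
    rw [hr] at h2 h3
    exact ⟨G, h0.trans (hneg 1), h1.trans (hneg 0), h2, h3, h4⟩

/-- The projection onto a line, as a function of the line. -/
def RP2.proj : RP2 → Fin 3 → Fin 3 → ℝ :=
  Quotient.lift (fun v i j => v.1 i * v.1 j / (v.1 ⬝ᵥ v.1)) (by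
    rintro v w ⟨c, hc, h⟩
    funext i j
    simp only [← h, Pi.smul_apply, smul_eq_mul, smul_dotProduct, dotProduct_smul]
    rw [show c * v.1 i * (c * v.1 j) = c * c * (v.1 i * v.1 j) by ring, ← mul_assoc c c,
      mul_div_mul_left _ _ (mul_ne_zero hc hc)])

theorem continuous_coord (i : Fin 3) : Continuous fun v : {v : Fin 3 → ℝ // v ≠ 0} => v.1 i :=
  (continuous_apply i).comp continuous_subtype_val

theorem RP2.continuous_proj : Continuous RP2.proj := by
  refine continuous_quot_lift _ ?_
  refine continuous_pi fun i => continuous_pi fun j => ?_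
  refine Continuous.div ((continuous_coord i).mul (continuous_coord j))
    (continuous_finsetSum _ fun k _ => (continuous_coord k).mul (continuous_coord k)) fun v h => ?_
  exact v.2 (dotProduct_self_eq_zero.1 h)

theorem RP2.injective_proj : Function.Injective RP2.proj := by
  rintro ⟨v⟩ ⟨w⟩ h
  have hv : v.1 ⬝ᵥ v.1 ≠ 0 := fun h => v.2 (dotProduct_self_eq_zero.1 h)
  have hw : w.1 ⬝ᵥ w.1 ≠ 0 := fun h => w.2 (dotProduct_self_eq_zero.1 h)
  have h' : ∀ i j, v.1 i * v.1 j / (v.1 ⬝ᵥ v.1) = w.1 i * w.1 j / (w.1 ⬝ᵥ w.1) :=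
    fun i j => congrFun (congrFun h i) j
  obtain ⟨j, hj⟩ := Function.ne_iff.1 v.2
  rw [Pi.zero_apply] at hj
  have hwj : w.1 j ≠ 0 := by
    intro h0
    have := h' j j
    rw [h0, mul_zero, zero_div, div_eq_zero_iff] at this
    exact this.elim (mul_self_ne_zero.2 hj) hv
  refine Quotient.sound ⟨w.1 ⬝ᵥ w.1 / (w.1 j * (v.1 ⬝ᵥ v.1)) * v.1 j, ?_, ?_⟩
  · exact mul_ne_zero (div_ne_zero hw (mul_ne_zero hwj hv)) hj
  · funext i
    have := h' i j
    field_simp at this ⊢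
    simp only [Pi.smul_apply, smul_eq_mul]
    field_simp
    linarith

instance : T2Space RP2 := .of_injective_continuous RP2.injective_proj RP2.continuous_proj

/-- The affine plane in the projective plane, in complex coordinates. -/
def affine (z : ℂ) : RP2 := planeToRP2 (z.re, z.im)

theorem affine_injective : Function.Injective affine := by
  intro z w h
  obtain ⟨c, -, hc⟩ := Quotient.exact h
  have h2 := congrFun hc 2
  have h0 := congrFun hc 0
  have h1 := congrFun hc 1
  simp at h0 h1 h2
  subst h2
  exact Complex.ext (by simpa using h0) (by simpa using h1)

theorem continuous_affine : Continuous affine := by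
  refine continuous_quot_mk.comp (Continuous.subtype_mk ?_ _)
  refine continuous_pi fun i => ?_
  fin_cases i
  · exact Complex.continuous_re
  · exact Complex.continuous_im
  · exact continuous_const

theorem isOpenMap_affine : IsOpenMap affine := by
  intro U hU
  let g : {v : Fin 3 → ℝ // v ≠ 0} → ℂ := fun v => ⟨v.1 0 / v.1 2, v.1 1 / v.1 2⟩
  have hg : ContinuousOn g {v | v.1 2 ≠ 0} := by
    have : ContinuousOn (fun v : {v : Fin 3 → ℝ // v ≠ 0} =>
        ((v.1 0 / v.1 2 : ℝ) : ℂ) + ((v.1 1 / v.1 2 : ℝ) : ℂ) * Complex.I) {v | v.1 2 ≠ 0} := by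
      refine ContinuousOn.add (Complex.continuous_ofReal.comp_continuousOn ?_)
        ((Complex.continuous_ofReal.comp_continuousOn ?_).mul continuousOn_const)
      · exact ContinuousOn.div (continuous_coord 0).continuousOn (continuous_coord 2).continuousOn
          (fun _ hv => hv)
      · exact ContinuousOn.div (continuous_coord 1).continuousOn (continuous_coord 2).continuousOn
          (fun _ hv => hv)
    exact this.congr fun v _ => Complex.mk_eq_add_mul_I _ _
  have hV : IsOpen {v : {v : Fin 3 → ℝ // v ≠ 0} | v.1 2 ≠ 0} :=
    isOpen_ne_fun (continuous_coord 2) continuous_const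
  have hpre : Quotient.mk projSetoid ⁻¹' (affine '' U) = {v | v.1 2 ≠ 0} ∩ g ⁻¹' U := by
    ext v
    constructor
    · rintro ⟨z, hz, h⟩
      obtain ⟨c, hc, h⟩ := Quotient.exact h
      have h2 := congrFun h 2
      have h0 := congrFun h 0
      have h1 := congrFun h 1
      simp at h0 h1 h2
      have : g v = z := Complex.ext (by simp [g, ← h0, ← h2, hc]) (by simp [g, ← h1, ← h2, hc])
      exact ⟨by rw [mem_ofPred_eq, ← h2]; exact hc, by rwa [mem_preimage, this]⟩
    · rintro ⟨h2, hU⟩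
      rw [mem_ofPred_eq] at h2
      refine ⟨g v, hU, Quotient.sound ⟨v.1 2, h2, ?_⟩⟩
      funext i
      fin_cases i
      · simp [g, mul_div_cancel₀ _ h2]
      · simp [g, mul_div_cancel₀ _ h2]
      · simp
  change IsOpen (Quotient.mk projSetoid ⁻¹' (affine '' U))
  rw [hpre]
  exact hg.isOpen_inter_preimage hV hU

/-- A closed curve separates its inside from infinity. -/
theorem IsPreconnected.subset_inside {x : ℂ} (C : Path x x) {S : Set RP2} (hS : IsPreconnected S)
    (hdisj : ∀ z ∈ range C, affine z ∉ S) {z : ℂ} (hz : affine z ∈ S) (h1 : turn z C = 1) :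
    S ⊆ affine '' {w | w ∉ range C ∧ turn w C = 1} := by
  have hopen : ∀ k, IsOpen {w | w ∉ range C ∧ turn w C = k} := fun k =>
    isOpen_iff_mem_nhds.2 fun w hw =>
      (turn_loop_eventually C hw.1).mono fun y hy => ⟨hy.1, hy.2.trans hw.2⟩
  obtain ⟨R, hR⟩ := exists_loop_bound C
  have hcompl : {w | w ∉ range C ∧ turn w C = 0}ᶜ =
      range C ∪ {w | w ∉ range C ∧ turn w C = 1} := by
    ext w
    have : turn w C ≠ 0 ↔ turn w C = 1 := by
      generalize turn w C = t; revert t; decide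
    simp only [mem_compl_iff, mem_ofPred_eq, mem_union, not_and, ← this]
    tauto
  have hcompact : IsCompact (range C ∪ {w | w ∉ range C ∧ turn w C = 1}) := by
    rw [← hcompl]
    refine Metric.isCompact_of_isClosed_isBounded (hopen 0).isClosed_compl
      ((Metric.isBounded_closedBall (x := 0) (r := R)).subset fun w hw => ?_)
    rw [mem_closedBall_zero_iff]
    by_contra! h
    refine hw ⟨?_, turn_loop_far C hR h.le⟩
    rintro ⟨t, rfl⟩
    exact h.not_gt (hR t)
  refine hS.subset_left_of_subset_union (isOpenMap_affine _ (hopen 1))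
    (hcompact.image continuous_affine).isClosed.isOpen_compl ?_ ?_ ?_
  · rw [disjoint_compl_right_iff_subset]
    exact image_mono subset_union_right
  · intro p hp
    by_contra h
    rw [mem_union, not_or, mem_compl_iff, not_not] at h
    obtain ⟨w, hw | hw, rfl⟩ := h.2
    · exact hdisj w hw hp
    · exact h.1 ⟨w, hw, rfl⟩
  · exact ⟨_, hz, z, ⟨fun h => hdisj z h hz, h1⟩, rfl⟩

/-- A pseudoline extending one of two arcs that cross oddly, and meeting the other only at these
crossings, leaves the affine plane. -/
theorem IsPseudoline.not_subset_affine {u a p q : ℂ} {L : Set RP2} (hL : IsPseudoline L)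
    (e : Path p q) (he : Function.Injective e) (hsub : ∀ z ∈ range e, affine z ∈ L)
    (δ : Path u a) (hδ : ∀ z ∈ range δ, affine z ∈ L → z ∈ range e)
    (hu : u ∉ range e) (ha : a ∉ range e) (hp : p ∉ range δ) (hq : q ∉ range δ)
    (hcross : cross e δ = 1) : ¬ L ⊆ range affine := by
  intro hLa
  obtain ⟨f, hf, hfi, rfl, hconn⟩ := hL
  obtain ⟨G, h0, h1, -, hGf, hGe⟩ := exists_arc_complement hf hfi
    (⟨fun t => affine (e t), continuous_affine.comp e.continuous⟩ : C(unitInterval, RP2))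
    (affine_injective.comp he) (by rintro _ ⟨t, rfl⟩; exact hsub _ ⟨t, rfl⟩)
  choose g hg using fun t => hLa (hGf ⟨t, rfl⟩)
  have hgc : Continuous g :=
    (Topology.IsOpenEmbedding.of_continuous_injective_isOpenMap continuous_affine affine_injective
      isOpenMap_affine).isEmbedding.continuous_iff.2 (by
        rw [show affine ∘ g = G from funext hg]; exact G.continuous)
  let γ : Path q p := ⟨⟨g, hgc⟩, affine_injective (by
      rw [ContinuousMap.toFun_eq_coe, ContinuousMap.coe_mk, hg, h0]
      exact congrArg affine e.target), affine_injective (by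
      rw [ContinuousMap.toFun_eq_coe, ContinuousMap.coe_mk, hg, h1]
      exact congrArg affine e.source)⟩
  have hγ : ∀ z ∈ range γ, affine z ∈ range f := by
    rintro _ ⟨t, rfl⟩
    exact hGf ⟨t, (hg t).symm⟩
  have hdisj : Disjoint (range γ) (range δ) := by
    rw [Set.disjoint_left]
    rintro _ ⟨t, rfl⟩ ht
    obtain ⟨s, hs⟩ := hδ _ ht (hγ _ ⟨t, rfl⟩)
    rcases hGe t ⟨s, (congrArg affine hs).trans (hg t)⟩ with rfl | rfl
    · exact hq (γ.source ▸ ht)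
    · exact hp (γ.target ▸ ht)
  have hnot : ∀ z ∈ range δ, z ∉ range e → z ∉ range (e.trans γ) := fun z hz hz' h => by
    rw [Path.trans_range] at h
    exact h.elim hz' fun h => Set.disjoint_left.1 hdisj h hz
  have hu' : u ∉ range γ := fun h => Set.disjoint_left.1 hdisj h ⟨0, δ.source⟩
  have ha' : a ∉ range γ := fun h => Set.disjoint_left.1 hdisj h ⟨1, δ.target⟩
  have hloop := loop_parity (e.trans γ) δ
  rw [cross_add_left (turn_trans _ _ hu hu') (turn_trans _ _ ha ha'), hcross,
    cross_eq_zero_of_disjoint _ _ hdisj] at hloop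
  have hsub' : ∀ z ∈ range (e.trans γ), affine z ∉ (range f)ᶜ := fun z hz h => by
    rw [Path.trans_range] at hz
    exact h (hz.elim (hsub z) (hγ z))
  have hmem : ∀ z ∈ range δ, z ∉ range e → affine z ∈ (range f)ᶜ := fun z hz hz' h =>
    hz' (hδ z hz h)
  have key : ∀ z w, z ∈ range δ → z ∉ range e → w ∈ range δ → w ∉ range e →
      turn z (e.trans γ) = 1 → turn w (e.trans γ) = 1 := by
    intro z w hz hz' hw hw' h
    obtain ⟨w', hw1, hw2⟩ := hconn.isPreconnected.subset_inside (e.trans γ) hsub'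
      (hmem z hz hz') h (hmem w hw hw')
    exact affine_injective hw2 ▸ hw1.2
  have k1 := key u a ⟨0, δ.source⟩ hu ⟨1, δ.target⟩ ha
  have k2 := key a u ⟨1, δ.target⟩ ha ⟨0, δ.source⟩ hu
  generalize turn u (e.trans γ) = s at *
  generalize turn a (e.trans γ) = t at *
  revert hloop k1 k2
  clear * -
  revert s t
  decide

/-- A pseudoline leaving the affine plane crosses the closed curves around the end of an arc on it
outside of this arc. -/
theorem IsPseudoline.exists_mem_loop {p q x : ℂ} {L : Set RP2} (hL : IsPseudoline L)
    (hLa : ¬ L ⊆ range affine) (e : Path p q) (he : Function.Injective e)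
    (hsub : ∀ z ∈ range e, affine z ∈ L) (C : Path x x) (hq : q ∉ range C) (h1 : turn q C = 1) :
    ∃ y ∈ range C, affine y ∈ L ∧ y ∉ range e := by
  obtain ⟨f, hf, hfi, rfl, -⟩ := hL
  obtain ⟨G, hG0, hG1, hfG, hGf, hGe⟩ := exists_arc_complement hf hfi
    (⟨fun t => affine (e t), continuous_affine.comp e.continuous⟩ : C(unitInterval, RP2))
    (affine_injective.comp he) (by rintro _ ⟨t, rfl⟩; exact hsub _ ⟨t, rfl⟩)
  simp only [ContinuousMap.coe_mk, e.source, e.target] at hG0 hG1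
  obtain ⟨w, hw, hwa⟩ := not_subset.1 hLa
  obtain ⟨t, rfl⟩ | ⟨t, rfl⟩ := hfG hw
  · exact absurd ⟨_, rfl⟩ hwa
  have ht : t < 1 := lt_of_le_of_ne t.2.2 fun h => hwa ⟨p, by rw [← hG1, h]⟩
  have hconn : IsPreconnected (G '' Icc 0 t) :=
    (isPreconnected_Icc).image _ G.continuous.continuousOn
  by_contra! h
  refine hwa ?_
  have hz : affine q ∈ G '' Icc 0 t := ⟨0, ⟨le_rfl, t.2.1⟩, hG0⟩
  suffices hC : ∀ z ∈ range C, affine z ∉ G '' Icc 0 t by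
    obtain ⟨y, -, hy⟩ := hconn.subset_inside C hC hz h1 ⟨t, ⟨t.2.1, le_rfl⟩, rfl⟩
    exact ⟨y, hy⟩
  rintro z hz ⟨s, hs, hsz⟩
  obtain ⟨r, hr⟩ := h z hz (hsz ▸ hGf ⟨s, rfl⟩)
  rcases hGe s ⟨r, (congrArg affine hr).trans hsz.symm⟩ with rfl | rfl
  · exact hq (affine_injective (hG0.symm.trans hsz) ▸ hz)
  · exact (hs.2.trans_lt ht).false

/-- The light edges of a frame are not contained in an arrangement of pseudolines. -/
theorem Frame.not_pseudolinear (F : Frame) (L : BaseEdge → Set RP2)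
    (hL : ∀ e, e.light = true → IsPseudoline (L e))
    (hsub : ∀ e, e.light = true → ∀ z ∈ range (F.arc e), affine z ∈ L e)
    (huniq : ∀ e f, e.light = true → f.light = true → e ≠ f → (L e ∩ L f).Subsingleton) :
    False := by
  obtain ⟨K, rfl⟩ := F.exists_cutFrame
  have heq : ∀ e f w z, e.light = true → f.light = true → e ≠ f → w ∈ range (K.arc e) →
      w ∈ range (K.arc f) → affine z ∈ L e → affine z ∈ L f → z = w :=
    fun e f w z he hf hef hwe hwf hze hzf =>
      affine_injective (huniq e f he hf hef ⟨hze, hzf⟩ ⟨hsub e he w hwe, hsub f hf w hwf⟩)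
  obtain ⟨i, hi⟩ := K.exists_turn_eq_one
  have hu : ∀ s, K.pt .u ∈ range (K.arc (.la i s)) := fun s => ⟨0, (K.arc (.la i s)).source⟩
  have hv : ∀ s, K.pt .v ∈ range (K.arc (.lb i s)) := fun s => ⟨0, (K.arc (.lb i s)).source⟩
  have hxa : ∀ s, K.x i s ∈ range (K.arc (.la i s)) := fun s => K.x_mem_la i s
  have hxb : ∀ s, K.x i s ∈ range (K.arc (.lb i s)) := fun s => K.x_mem_lb i s
  have hav : ∀ e x, x ≠ BaseEdge.src e → x ≠ BaseEdge.tgt e → K.pt x ∉ range (K.arc e) :=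
    fun e x h1 h2 h3 => (K.avoid e x h3).elim h1 h2
  have hua : ∀ s, K.pt .u ∉ range (K.lb i s) := fun s =>
    hav (.lb i s) _ (by simp [src]) (by simp [tgt])
  have haa : ∀ s, K.pt (.a i s) ∉ range (K.lb i s) := fun s =>
    hav (.lb i s) _ (by simp [src]) (by simp [tgt])
  have hvb : ∀ s, K.pt .v ∉ range (K.la i s) := fun s =>
    hav (.la i s) _ (by simp [src]) (by simp [tgt])
  have hbb : ∀ s, K.pt (.b i s) ∉ range (K.la i s) := fun s =>
    hav (.la i s) _ (by simp [src]) (by simp [tgt])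
  have hab : ∀ s, cross (K.lb i s) (K.la i s) = 1 := fun s =>
    (cross_comm _ _ (hvb s) (hbb s)).trans (K.cross_la_lb i s)
  obtain ⟨y, hyC, hyL, hy⟩ := (hL (.lb i false) rfl).exists_mem_loop
    ((hL (.lb i false) rfl).not_subset_affine (K.lb i false) (K.arc_inj _) (hsub (.lb i false) rfl)
      (K.la i false) (fun z hz hzL => heq (.la i false) (.lb i false) _ z rfl rfl (by simp)
        (hxa _) (hxb _) (hsub (.la i false) rfl z hz) hzL ▸ hxb _)
      (hua _) (haa _) (hvb _) (hbb _) (hab _))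
    (K.lb i false) (K.arc_inj _) (hsub (.lb i false) rfl) (K.loop i)
    (K.pt_notMem_loop (by simp) (by simp)) (hi false).2
  obtain ⟨y', hyC', hyL', hy'⟩ := (hL (.la i true) rfl).exists_mem_loop
    ((hL (.la i true) rfl).not_subset_affine (K.la i true) (K.arc_inj _) (hsub (.la i true) rfl)
      (K.lb i true) (fun z hz hzL => heq (.la i true) (.lb i true) _ z rfl rfl (by simp)
        (hxa _) (hxb _) hzL (hsub (.lb i true) rfl z hz) ▸ hxa _)
      (hvb _) (hbb _) (hua _) (haa _) (K.cross_la_lb _ _))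
    (K.la i true) (K.arc_inj _) (hsub (.la i true) rfl) (K.loop i)
    (K.pt_notMem_loop (by simp) (by simp)) (hi true).1
  have hya : y ∈ range (K.arc (.la i true)) := by
    rcases K.mem_loop.1 hyC with ((h | h) | h) | h
    · exact absurd (heq (.la i false) (.lb i false) _ y rfl rfl (by simp) (hxa _) (hxb _)
        (hsub _ rfl y (K.la₁_subset _ _ h)) hyL ▸ hxb _) hy
    · exact absurd (K.lb₁_subset _ _ h) hy
    · exact absurd (heq (.lb i true) (.lb i false) _ y rfl rfl (by simp) (hv _) (hv _)
        (hsub _ rfl y (K.lb₁_subset _ _ h)) hyL ▸ hv _) hy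
    · exact K.la₁_subset _ _ h
  have hyb : y' ∈ range (K.arc (.lb i false)) := by
    rcases K.mem_loop.1 hyC' with ((h | h) | h) | h
    · exact absurd (heq (.la i false) (.la i true) _ y' rfl rfl (by simp) (hu _) (hu _)
        (hsub _ rfl y' (K.la₁_subset _ _ h)) hyL' ▸ hu _) hy'
    · exact K.lb₁_subset _ _ h
    · exact absurd (heq (.lb i true) (.la i true) _ y' rfl rfl (by simp) (hxb _) (hxa _)
        (hsub _ rfl y' (K.lb₁_subset _ _ h)) hyL' ▸ hxa _) hy'
    · exact absurd (K.la₁_subset _ _ h) hy'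
  have : y = y' := affine_injective (huniq (.la i true) (.lb i false) rfl rfl (by simp)
    ⟨hsub _ rfl y hya, hyL⟩ ⟨hyL', hsub _ rfl y' hyb⟩)
  exact hy (this ▸ hyb)

theorem Path.trans_injective {X : Type*} [TopologicalSpace X] {a b c : X} {γ : Path a b}
    {δ : Path b c} (hγ : Function.Injective γ) (hδ : Function.Injective δ)
    (h : range γ ∩ range δ ⊆ {b}) : Function.Injective (γ.trans δ) := by
  have key : ∀ s t : unitInterval, (s : ℝ) ≤ 1 / 2 → ¬ (t : ℝ) ≤ 1 / 2 →
      γ.trans δ s ≠ γ.trans δ t := by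
    intro s t hs ht hst
    rw [Path.trans_apply, Path.trans_apply, dif_pos hs, dif_neg ht] at hst
    have hb := h ⟨⟨_, rfl⟩, ⟨_, hst.symm⟩⟩
    rw [hst] at hb
    have := hδ (hb.trans δ.source.symm)
    have := congrArg Subtype.val this
    simp only [Icc.coe_zero] at this
    linarith
  intro s t hst
  by_cases hs : (s : ℝ) ≤ 1 / 2 <;> by_cases ht : (t : ℝ) ≤ 1 / 2
  · rw [Path.trans_apply, Path.trans_apply, dif_pos hs, dif_pos ht] at hst
    have := congrArg Subtype.val (hγ hst)
    exact Subtype.ext (by simpa using this)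
  · exact absurd hst (key s t hs ht)
  · exact absurd hst.symm (key t s ht hs)
  · rw [Path.trans_apply, Path.trans_apply, dif_neg hs, dif_neg ht] at hst
    have := congrArg Subtype.val (hδ hst)
    exact Subtype.ext (by simpa using this)

namespace Drawing

variable {V : Type*} {G : SimpleGraph V} (D : Drawing G)

/-- The position of a vertex as a complex number. -/
def pos (v : V) : ℂ := Complex.equivRealProd.symm (D.vert v)

/-- The points of the arc of an edge as complex numbers. -/
def trace (e : G.edgeSet) : Set ℂ := (fun t => Complex.equivRealProd.symm (D.arc e t)) '' Icc 0 1

theorem pos_injective : Function.Injective D.pos :=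
  Complex.equivRealProd.symm.injective.comp D.vert_inj

theorem affine_equivRealProd_symm (p : Plane) :
    affine (Complex.equivRealProd.symm p) = planeToRP2 p := rfl

theorem exists_path {x y : V} (h : G.Adj x y) : ∃ γ : Path (D.pos x) (D.pos y),
    Function.Injective γ ∧ range γ = D.trace ⟨s(x, y), h⟩ := by
  have hc : Continuous fun t : unitInterval =>
      Complex.equivRealProd.symm (D.arc ⟨s(x, y), h⟩ t) :=
    Complex.equivRealProdCLM.symm.continuous.comp
      (continuousOn_iff_continuous_domRestrict.1 (D.arc_cont ⟨s(x, y), h⟩))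
  obtain ⟨x', y', hxy, h0, h1⟩ := D.arc_ends ⟨s(x, y), h⟩
  let γ : Path (D.pos x') (D.pos y') := ⟨⟨_, hc⟩, congrArg Complex.equivRealProd.symm h0,
    congrArg Complex.equivRealProd.symm h1⟩
  have hi : Function.Injective γ := fun s t hst => Subtype.ext
    (D.arc_injOn _ s.2 t.2 (Complex.equivRealProd.symm.injective hst))
  have hr : range γ = D.trace ⟨s(x, y), h⟩ := by
    ext z
    constructor
    · rintro ⟨t, rfl⟩; exact ⟨t, t.2, rfl⟩
    · rintro ⟨t, ht, rfl⟩; exact ⟨⟨t, ht⟩, rfl⟩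
  rcases Sym2.eq_iff.1 hxy with ⟨rfl, rfl⟩ | ⟨rfl, rfl⟩
  · exact ⟨γ, hi, hr⟩
  · refine ⟨γ.symm, ?_, by rw [Path.symm_range, hr]⟩
    exact hi.comp unitInterval.symm_bijective.injective

theorem exists_vert_of_end {e : G.edgeSet} {t : ℝ} (h : t = 0 ∨ t = 1) :
    ∃ w ∈ (e : Sym2 V), D.arc e t = D.vert w := by
  obtain ⟨x, y, hxy, h0, h1⟩ := D.arc_ends e
  rcases h with rfl | rfl
  · exact ⟨x, by simp [hxy], h0⟩
  · exact ⟨y, by simp [hxy], h1⟩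

theorem mem_of_pos_mem_trace {w : V} {e : G.edgeSet} (h : D.pos w ∈ D.trace e) :
    w ∈ (e : Sym2 V) := by
  obtain ⟨t, ht, h⟩ := h
  have h := Complex.equivRealProd.symm.injective h
  obtain ⟨w', hw', h'⟩ := D.exists_vert_of_end (D.arc_avoid e t ht ⟨w, h⟩)
  exact D.vert_inj (h.symm.trans h') ▸ hw'

theorem trace_inter {e f : G.edgeSet} (hef : e ≠ f) (h : ∀ p, (p, s(e, f)) ∉ D.CrossSet) {z : ℂ}
    (he : z ∈ D.trace e) (hf : z ∈ D.trace f) :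
    ∃ w ∈ (e : Sym2 V), w ∈ (f : Sym2 V) ∧ z = D.pos w := by
  have key : ∀ {e f : G.edgeSet} (s : ℝ), (s = 0 ∨ s = 1) →
      z = Complex.equivRealProd.symm (D.arc e s) → z ∈ D.trace f →
      ∃ w ∈ (e : Sym2 V), w ∈ (f : Sym2 V) ∧ z = D.pos w := by
    intro e f s hs hz hf
    obtain ⟨w, hw, h⟩ := D.exists_vert_of_end (e := e) hs
    have hz : z = D.pos w := hz.trans (congrArg _ h)
    exact ⟨w, hw, D.mem_of_pos_mem_trace (hz ▸ hf), hz⟩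
  obtain ⟨s, hs, hsz⟩ := id he
  obtain ⟨t, ht, htz⟩ := id hf
  by_cases hs' : s = 0 ∨ s = 1
  · exact key s hs' hsz.symm hf
  by_cases ht' : t = 0 ∨ t = 1
  · obtain ⟨w, h1, h2, h3⟩ := key t ht' htz.symm he
    exact ⟨w, h2, h1, h3⟩
  have hI : ∀ r ∈ Icc (0 : ℝ) 1, ¬ (r = 0 ∨ r = 1) → r ∈ Ioo (0 : ℝ) 1 := fun r hr h =>
    ⟨lt_of_le_of_ne hr.1 fun h' => h (Or.inl h'.symm), lt_of_le_of_ne hr.2 fun h' => h (Or.inr h')⟩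
  exact absurd ⟨e, f, hef, rfl, ⟨s, hI s hs hs', rfl⟩, ⟨t, hI t ht ht',
    Complex.equivRealProd.symm.injective (htz.trans hsz.symm)⟩⟩ (h (D.arc e s))

end Drawing

/-- The base graph with each heavy edge replaced by `M` paths of length two. -/
def heavyGraph (M : ℕ) : SimpleGraph (BaseVertex ⊕ BaseEdge × Fin M) :=
  .fromRel fun x y => match x, y with
    | .inl x, .inl y => ∃ e : BaseEdge, e.light = true ∧ x = e.src ∧ y = e.tgt
    | .inl x, .inr (e, _) => e.light = false ∧ (x = e.src ∨ x = e.tgt)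
    | _, _ => False

theorem BaseEdge.src_ne_tgt (e : BaseEdge) : e.src ≠ e.tgt := by cases e <;> simp [src, tgt]

theorem BaseEdge.ext_ends : ∀ e f : BaseEdge, s(e.src, e.tgt) = s(f.src, f.tgt) → e = f := by
  decide

theorem BaseEdge.common_end {e f : BaseEdge} (hef : e ≠ f) {x y : BaseVertex}
    (hxe : x = e.src ∨ x = e.tgt) (hye : y = e.src ∨ y = e.tgt)
    (hxf : x = f.src ∨ x = f.tgt) (hyf : y = f.src ∨ y = f.tgt) : x = y := by
  by_contra hxy
  have key : ∀ g : BaseEdge, (x = g.src ∨ x = g.tgt) → (y = g.src ∨ y = g.tgt) →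
      s(g.src, g.tgt) = s(x, y) := by
    rintro g (rfl | rfl) (h | h)
    · exact absurd h.symm hxy
    · rw [h]
    · rw [h, Sym2.eq_swap]
    · exact absurd h.symm hxy
  exact hef (ext_ends e f ((key e hxe hye).trans (key f hxf hyf).symm))

theorem heavyGraph_adj_light {M : ℕ} {e : BaseEdge} (he : e.light = true) :
    (heavyGraph M).Adj (.inl e.src) (.inl e.tgt) :=
  ⟨by simpa using e.src_ne_tgt, Or.inl ⟨e, he, rfl, rfl⟩⟩

theorem heavyGraph_adj_src {M : ℕ} {e : BaseEdge} (he : e.light = false) (j : Fin M) :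
    (heavyGraph M).Adj (.inl e.src) (.inr (e, j)) :=
  ⟨by simp, Or.inl ⟨he, Or.inl rfl⟩⟩

theorem heavyGraph_adj_tgt {M : ℕ} {e : BaseEdge} (he : e.light = false) (j : Fin M) :
    (heavyGraph M).Adj (.inr (e, j)) (.inl e.tgt) :=
  ⟨by simp, Or.inr ⟨he, Or.inr rfl⟩⟩

namespace Drawing

variable {V : Type*} {G : SimpleGraph V} (D : Drawing G)

/-- Having no crossings. -/
def IsClean (e : G.edgeSet) : Prop := ∀ x ∈ D.CrossSet, e ∉ x.2

theorem exists_isClean {m : ℕ} (hfin : D.CrossSet.Finite) (hm : D.CrossSet.ncard < m)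
    (g : Fin (2 * m) → Bool → G.edgeSet) (hg : ∀ i j s t, g i s = g j t → i = j) :
    ∃ j, ∀ s, D.IsClean (g j s) := by
  by_contra! h
  simp only [IsClean, not_forall, not_not] at h
  choose s x hx hgx using h
  have hout : ∀ j, g j (s j) = (Quot.out (x j).2).1 ∨ g j (s j) = (Quot.out (x j).2).2 := by
    intro j
    have h := hgx j
    rw [← Quot.out_eq (x j).2] at h
    exact Sym2.mem_iff.1 h
  classical
  let F : Fin (2 * m) → D.CrossSet × Bool := fun j =>
    (⟨x j, hx j⟩, decide (g j (s j) = (Quot.out (x j).2).1))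
  have hF : Function.Injective F := by
    intro i j hij
    obtain ⟨h1, h2⟩ := Prod.mk.inj hij
    have h1 : x i = x j := congrArg Subtype.val h1
    rw [decide_eq_decide, h1] at h2
    have hi := hout i
    have hj := hout j
    rw [h1] at hi
    by_cases h : g j (s j) = (Quot.out (x j).2).1
    · exact hg _ _ _ _ ((h2.2 h).trans h.symm)
    · exact hg _ _ _ _ ((hi.resolve_left fun h' => h (h2.1 h')).trans (hj.resolve_left h).symm)
  have := hfin.to_subtype
  have := Nat.card_le_card_of_injective F hF
  rw [Nat.card_prod, Nat.card_coe_set_eq, Nat.card_eq_fintype_card, Fintype.card_fin,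
    Nat.card_eq_fintype_card, Fintype.card_bool] at this
  omega

variable {m : ℕ} {φ : BaseVertex ⊕ BaseEdge × Fin (2 * m) → V}

theorem exists_base_arc (hφ : Function.Injective φ)
    (hadj : ∀ x y, (heavyGraph (2 * m)).Adj x y → G.Adj (φ x) (φ y))
    (hfin : D.CrossSet.Finite) (hm : D.CrossSet.ncard < m) (e : BaseEdge) :
    ∃ (γ : Path (D.pos (φ (.inl e.src))) (D.pos (φ (.inl e.tgt)))) (S : Set G.edgeSet),
      Function.Injective γ ∧ range γ = (⋃ g ∈ S, D.trace g) ∧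
      (e.light = true → ∃ h, S = {⟨s(φ (.inl e.src), φ (.inl e.tgt)), h⟩}) ∧
      (e.light = false → ∀ g ∈ S, D.IsClean g ∧ ∃ j, φ (.inr (e, j)) ∈ (g : Sym2 V)) ∧
      ∀ g ∈ S, ∀ w ∈ (g : Sym2 V), w = φ (.inl e.src) ∨ w = φ (.inl e.tgt) ∨
        ∃ j, w = φ (.inr (e, j)) := by
  rcases hl : e.light with _ | _
  · have h1 := fun j => hadj _ _ (heavyGraph_adj_src hl j)
    have h2 := fun j => hadj _ _ (heavyGraph_adj_tgt hl j)
    let g : Fin (2 * m) → Bool → G.edgeSet := fun j s => match s with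
      | true => ⟨s(φ (.inl e.src), φ (.inr (e, j))), h1 j⟩
      | false => ⟨s(φ (.inr (e, j)), φ (.inl e.tgt)), h2 j⟩
    have hgmem : ∀ j s, φ (.inr (e, j)) ∈ (g j s : Sym2 V) := by
      intro j s
      cases s <;> simp [g]
    have hgends : ∀ j s, ∀ w ∈ (g j s : Sym2 V), w = φ (.inl e.src) ∨ w = φ (.inl e.tgt) ∨
        w = φ (.inr (e, j)) := by
      rintro j (_ | _) w hw
      · exact Or.inr ((Sym2.mem_iff.1 hw).symm)
      · rcases Sym2.mem_iff.1 hw with h | h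
        · exact Or.inl h
        · exact Or.inr (Or.inr h)
    obtain ⟨j, hj⟩ := D.exists_isClean hfin hm g (by
      intro i j s t h
      rcases hgends j t _ (h ▸ hgmem i s) with h | h | h
      all_goals simpa using hφ h)
    obtain ⟨γ₁, hi₁, hr₁⟩ := D.exists_path (h1 j)
    obtain ⟨γ₂, hi₂, hr₂⟩ := D.exists_path (h2 j)
    have hne : g j true ≠ g j false := by
      intro h
      have h := congrArg Subtype.val h
      have := hφ.ne (Sum.inl_injective.ne e.src_ne_tgt :
        (Sum.inl e.src : BaseVertex ⊕ BaseEdge × Fin (2 * m)) ≠ _)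
      rcases Sym2.eq_iff.1 h with ⟨h, -⟩ | ⟨h, -⟩
      · simpa using hφ h
      · exact this h
    refine ⟨γ₁.trans γ₂, {g j true, g j false}, Path.trans_injective hi₁ hi₂ ?_, ?_, by simp,
      fun _ => ?_, ?_⟩
    · rintro z ⟨hz1, hz2⟩
      rw [hr₁] at hz1
      rw [hr₂] at hz2
      obtain ⟨w, hw1, hw2, rfl⟩ := D.trace_inter hne
        (fun p hp => hj true _ hp (Sym2.mem_mk_left _ _)) hz1 hz2
      rcases Sym2.mem_iff.1 hw1 with rfl | rfl
      · rcases Sym2.mem_iff.1 hw2 with h | h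
        · simpa using hφ h
        · exact absurd (Sum.inl_injective (hφ h)) e.src_ne_tgt
      · rfl
    · rw [Path.trans_range, hr₁, hr₂, biUnion_pair]
    · rintro g (rfl | rfl)
      · exact ⟨hj true, j, hgmem j true⟩
      · exact ⟨hj false, j, hgmem j false⟩
    · rintro g (rfl | rfl) w hw
      · rcases hgends j true w hw with h | h | h
        exacts [Or.inl h, Or.inr (Or.inl h), Or.inr (Or.inr ⟨j, h⟩)]
      · rcases hgends j false w hw with h | h | h
        exacts [Or.inl h, Or.inr (Or.inl h), Or.inr (Or.inr ⟨j, h⟩)]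
  · have h := hadj _ _ (heavyGraph_adj_light hl)
    obtain ⟨γ, hi, hr⟩ := D.exists_path h
    refine ⟨γ, {⟨_, h⟩}, hi, by rw [hr, biUnion_singleton], fun _ => ⟨h, rfl⟩, by simp, ?_⟩
    rintro g rfl w hw
    rcases Sym2.mem_iff.1 hw with h | h
    exacts [Or.inl h, Or.inr (Or.inl h)]

/-- Pseudolinear drawings of the heavy graph have many crossings. -/
theorem le_ncard_crossSet (hφ : Function.Injective φ)
    (hadj : ∀ x y, (heavyGraph (2 * m)).Adj x y → G.Adj (φ x) (φ y))
    (hfin : D.CrossSet.Finite) (hD : D.IsPseudolinear) : m ≤ D.CrossSet.ncard := by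
  by_contra! hm
  obtain ⟨L, hL, hLD, hLu⟩ := hD
  choose γ S hinj hrange hlight hheavy hends using D.exists_base_arc hφ hadj hfin hm
  let pt : BaseVertex → ℂ := fun x => D.pos (φ (.inl x))
  have hpt : Function.Injective pt := D.pos_injective.comp (hφ.comp Sum.inl_injective)
  have hmem : ∀ e w, ∀ g ∈ S e, φ (.inl w) ∈ (g : Sym2 V) → w = e.src ∨ w = e.tgt := by
    intro e w g hg hw
    rcases hends e g hg _ hw with h | h | ⟨j, h⟩
    · exact Or.inl (Sum.inl_injective (hφ h))
    · exact Or.inr (Sum.inl_injective (hφ h))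
    · simpa using hφ h
  have hne : ∀ e f, e ≠ f → ∀ g ∈ S e, ∀ h ∈ S f, g ≠ h := by
    have key : ∀ e f, e ≠ f → e.light = false → ∀ g ∈ S e, ∀ h ∈ S f, g ≠ h := by
      rintro e f hef he g hg _ hh rfl
      obtain ⟨-, j, hj⟩ := hheavy e he g hg
      rcases hends f g hh _ hj with h | h | ⟨j', h⟩
      all_goals simpa [hef] using hφ h
    intro e f hef g hg h hh
    rcases he : e.light with _ | _
    · exact key e f hef he g hg h hh
    rcases hf : f.light with _ | _
    · exact (key f e hef.symm hf h hh g hg).symm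
    obtain ⟨h1, hS1⟩ := hlight e he
    obtain ⟨h2, hS2⟩ := hlight f hf
    rw [hS1] at hg
    rw [hS2] at hh
    rw [mem_singleton_iff] at hg hh
    subst hg hh
    intro h
    have hi := hφ.comp Sum.inl_injective
    have h := congrArg Subtype.val h
    exact hef (ext_ends e f (Sym2.map.injective hi h))
  have hinter : ∀ e f, e ≠ f → (e.light && f.light) = false → ∀ z ∈ range (γ e), z ∈ range (γ f) →
      ∃ y, (y = e.src ∨ y = e.tgt) ∧ (y = f.src ∨ y = f.tgt) ∧ z = pt y := by
    intro e f hef hl z hze hzf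
    rw [hrange] at hze hzf
    simp only [mem_iUnion] at hze hzf
    obtain ⟨g, hg, hzg⟩ := hze
    obtain ⟨h, hh, hzh⟩ := hzf
    obtain ⟨w, hwg, hwh, rfl⟩ := D.trace_inter (hne e f hef g hg h hh) (fun p hp => by
      rcases (Bool.and_eq_false_iff.1 hl) with hl | hl
      · exact (hheavy e hl g hg).1 _ hp (Sym2.mem_mk_left _ _)
      · exact (hheavy f hl h hh).1 _ hp (Sym2.mem_mk_right _ _)) hzg hzh
    have h1 := hends e g hg w hwg
    have h2 := hends f h hh w hwh
    have key : ∀ y, w = φ (.inl y) → ∃ y, (y = e.src ∨ y = e.tgt) ∧ (y = f.src ∨ y = f.tgt) ∧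
        D.pos w = pt y := by
      rintro y rfl
      exact ⟨y, hmem e y g hg hwg, hmem f y h hh hwh, rfl⟩
    rcases h1 with h1 | h1 | ⟨j, h1⟩
    · exact key _ h1
    · exact key _ h1
    rcases h2 with h2 | h2 | ⟨j', h2⟩
    · exact key _ h2
    · exact key _ h2
    · rw [h1] at h2
      have := hφ h2
      simp [hef] at this
  classical
  let L' : BaseEdge → Set RP2 := fun e =>
    if h : e.light = true then L ⟨_, (hlight e h).choose⟩ else ∅
  have hL' : ∀ e, e.light = true → ∃ g ∈ S e, L' e = L g := fun e he =>
    ⟨_, (hlight e he).choose_spec.symm.subset rfl, dif_pos he⟩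
  have hsub : ∀ e, e.light = true → ∀ z ∈ range (γ e), affine z ∈ L' e := by
    intro e he z hz
    have hS := (hlight e he).choose_spec
    simp only [L', dif_pos he]
    rw [hrange, hS, biUnion_singleton] at hz
    obtain ⟨t, ht, rfl⟩ := hz
    exact hLD _ t ht
  have huniq : ∀ e f, e.light = true → f.light = true → e ≠ f → (L' e ∩ L' f).Subsingleton := by
    intro e f he hf hef
    obtain ⟨g, hg, hge⟩ := hL' e he
    obtain ⟨h, hh, hhf⟩ := hL' f hf
    rw [hge, hhf]
    exact fun p hp q hq => (hLu g h (hne e f hef g hg h hh)).unique hp hq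
  have hmeet : ∀ e f, e.light = true → f.light = true → e ≠ f →
      (range (γ e) ∩ range (γ f)).Subsingleton := fun e f he hf hef p hp q hq =>
    affine_injective (huniq e f he hf hef ⟨hsub e he p hp.1, hsub f hf p hp.2⟩
      ⟨hsub e he q hq.1, hsub f hf q hq.2⟩)
  have hpt_mem : ∀ e x, (x = e.src ∨ x = e.tgt) → pt x ∈ range (γ e) := by
    rintro e x (rfl | rfl)
    exacts [⟨0, (γ e).source⟩, ⟨1, (γ e).target⟩]
  let F : Frame :=
    { pt := pt
      pt_inj := hpt
      arc := γ
      arc_inj := hinj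
      avoid := by
        intro e x hx
        rw [hrange] at hx
        simp only [mem_iUnion] at hx
        obtain ⟨g, hg, hx⟩ := hx
        exact hmem e x g hg (D.mem_of_pos_mem_trace hx)
      disj := by
        intro e f hef hl
        rw [Set.disjoint_left]
        intro z hze hzf
        obtain ⟨y, hy, hy', -⟩ := hinter e f (by rintro rfl; exact hef.1 rfl) hl z hze hzf
        obtain ⟨h1, h2, h3, h4⟩ := hef
        rcases hy with rfl | rfl <;> rcases hy' with h | h <;> contradiction
      adj := by
        rintro e f x hef hxe hxf z ⟨hze, hzf⟩
        rcases hl : (e.light && f.light) with _ | _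
        · obtain ⟨y, hy, hy', rfl⟩ := hinter e f hef hl z hze hzf
          rw [common_end hef hxe hy hxf hy']
          rfl
        · rw [Bool.and_eq_true] at hl
          exact hmeet e f hl.1 hl.2 hef ⟨hze, hzf⟩ ⟨hpt_mem e x hxe, hpt_mem f x hxf⟩
      meet := by
        rintro e f hef
        rcases hl : (e.light && f.light) with _ | _
        · rintro p ⟨hp, hp'⟩ q ⟨hq, hq'⟩
          obtain ⟨y, hy, hy', rfl⟩ := hinter e f hef hl p hp hp'
          obtain ⟨x, hx, hx', rfl⟩ := hinter e f hef hl q hq hq'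
          rw [common_end hef hx hy hx' hy']
        · rw [Bool.and_eq_true] at hl
          exact hmeet e f hl.1 hl.2 hef }
  refine F.not_pseudolinear L' (fun e he => ?_) hsub huniq
  obtain ⟨g, -, hg⟩ := hL' e he
  exact hg ▸ hL g

end Drawing

/-- The complete bipartite graph with two sides of size three. -/
abbrev K33 : SimpleGraph (Fin 3 ⊕ Fin 3) := completeBipartiteGraph (Fin 3) (Fin 3)

theorem Drawing.crossSet_K33_nonempty (D : Drawing K33) : D.CrossSet.Nonempty := by
  by_contra hD
  rw [not_nonempty_iff_eq_empty] at hD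
  have hadj : ∀ i j : Fin 3, K33.Adj (.inl i) (.inr j) := fun i j => by simp
  choose γ hi hr using fun i j => D.exists_path (hadj i j)
  have hdisj : ∀ i j k l, i ≠ k → j ≠ l → Disjoint (range (γ i j)) (range (γ k l)) := by
    intro i j k l hik hjl
    rw [Set.disjoint_left]
    intro z h1 h2
    rw [hr] at h1 h2
    obtain ⟨w, hw, hw', -⟩ := D.trace_inter (fun h => by
      have h := congrArg Subtype.val h
      simp_all) (by simp [hD]) h1 h2
    rcases Sym2.mem_iff.1 hw with rfl | rfl <;> rcases Sym2.mem_iff.1 hw' with h | h <;>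
      simp_all
  have hc : ∀ i j k l, i ≠ k → j ≠ l → cross (γ i j) (γ k l) = 0 := fun i j k l h h' =>
    cross_eq_zero_of_disjoint _ _ (hdisj i j k l h h')
  have hc' : ∀ i j k l, i ≠ k → j ≠ l → cross (γ i j) (γ k l).symm = 0 := fun i j k l h h' =>
    cross_eq_zero_of_disjoint _ _ (by rw [Path.symm_range]; exact hdisj i j k l h h')
  have hc'' : ∀ i j k l, i ≠ k → j ≠ l → cross (γ i j).symm (γ k l) = 0 := fun i j k l h h' =>
    cross_eq_zero_of_disjoint _ _ (by rw [Path.symm_range]; exact hdisj i j k l h h')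
  have key := k4_parity (γ 0 0) (γ 0 1) (γ 1 0) (γ 1 1) (γ 0 2) (γ 1 2) (γ 2 0).symm (γ 2 1).symm
    (by simp [D.pos_injective.eq_iff]) (hc _ _ _ _ (by decide) (by decide))
    (hc _ _ _ _ (by decide) (by decide)) (hc _ _ _ _ (by decide) (by decide))
    (hc _ _ _ _ (by decide) (by decide)) (hc' _ _ _ _ (by decide) (by decide))
    (hc' _ _ _ _ (by decide) (by decide)) (hc _ _ _ _ (by decide) (by decide))
    (hc _ _ _ _ (by decide) (by decide)) (hc' _ _ _ _ (by decide) (by decide))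
    (hc' _ _ _ _ (by decide) (by decide)) (hc'' _ _ _ _ (by decide) (by decide))
    (hc'' _ _ _ _ (by decide) (by decide)) (hc'' _ _ _ _ (by decide) (by decide))
    (hc'' _ _ _ _ (by decide) (by decide))
  have h1 := hc 0 0 2 2 (by decide) (by decide)
  have h2 := hc 0 1 2 2 (by decide) (by decide)
  have h3 := hc 1 0 2 2 (by decide) (by decide)
  have h4 := hc 1 1 2 2 (by decide) (by decide)
  simp only [cross] at h1 h2 h3 h4
  grind

namespace Drawing

variable {V W : Type*} {G : SimpleGraph V} {H : SimpleGraph W}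

theorem crNum_le (D : Drawing G) (h : D.CrossSet.Finite) : crNum G ≤ D.CrossSet.ncard :=
  Nat.sInf_le ⟨D, trivial, h, rfl⟩

theorem exists_ncard_eq_crNum (h : ∃ D : Drawing G, D.CrossSet.Finite) :
    ∃ D : Drawing G, D.CrossSet.Finite ∧ D.CrossSet.ncard = crNum G := by
  obtain ⟨D, h⟩ := h
  obtain ⟨D, -, h⟩ := Nat.sInf_mem (s := {n | ∃ D : Drawing G, True ∧ D.CrossSet.Finite ∧
    D.CrossSet.ncard = n}) ⟨_, D, trivial, h, rfl⟩
  exact ⟨D, h⟩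

/-- The drawing induced on a subgraph. -/
def comap (D : Drawing H) (f : G →g H) (hf : Function.Injective f) : Drawing G where
  vert := D.vert ∘ f
  vert_inj := D.vert_inj.comp hf
  arc e := D.arc (f.mapEdgeSet e)
  arc_cont e := D.arc_cont _
  arc_injOn e := D.arc_injOn _
  arc_ends := by
    rintro ⟨⟨a, b⟩, he⟩
    obtain ⟨x, y, hxy, h0, h1⟩ := D.arc_ends (f.mapEdgeSet ⟨s(a, b), he⟩)
    rcases Sym2.eq_iff.1 hxy with ⟨rfl, rfl⟩ | ⟨rfl, rfl⟩
    · exact ⟨a, b, rfl, h0, h1⟩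
    · exact ⟨b, a, Sym2.eq_swap, h0, h1⟩
  arc_avoid := fun e t ht ⟨v, h⟩ => D.arc_avoid _ t ht ⟨f v, h⟩

theorem crossSet_comap (D : Drawing H) (f : G →g H) (hf : Function.Injective f) :
    Prod.map id (Sym2.map f.mapEdgeSet) '' (D.comap f hf).CrossSet ⊆ D.CrossSet := by
  rintro _ ⟨⟨p, _⟩, ⟨e, g, hne, rfl, h1, h2⟩, rfl⟩
  exact ⟨_, _, (SimpleGraph.Hom.mapEdgeSet.injective f hf).ne hne, rfl, h1, h2⟩

theorem injective_map_edges (f : G →g H) (hf : Function.Injective f) :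
    Function.Injective (Prod.map (id : Plane → Plane) (Sym2.map f.mapEdgeSet)) :=
  Function.injective_id.prodMap (Sym2.map.injective (SimpleGraph.Hom.mapEdgeSet.injective f hf))

theorem finite_crossSet_comap (D : Drawing H) (f : G →g H) (hf : Function.Injective f)
    (h : D.CrossSet.Finite) : (D.comap f hf).CrossSet.Finite :=
  .of_finite_image (h.subset (D.crossSet_comap f hf)) (injective_map_edges f hf).injOn

theorem ncard_crossSet_comap (D : Drawing H) (f : G →g H) (hf : Function.Injective f) :
    (Prod.map id (Sym2.map f.mapEdgeSet) '' (D.comap f hf).CrossSet).ncard =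
      (D.comap f hf).CrossSet.ncard :=
  ncard_image_of_injective _ (injective_map_edges f hf)

theorem _root_.crNum_mono (f : G →g H) (hf : Function.Injective f)
    (h : ∃ D : Drawing H, D.CrossSet.Finite) : crNum G ≤ crNum H := by
  obtain ⟨D, hD, h⟩ := exists_ncard_eq_crNum h
  rw [← h]
  refine (crNum_le _ (D.finite_crossSet_comap f hf hD)).trans ?_
  rw [← D.ncard_crossSet_comap]
  exact ncard_le_ncard (D.crossSet_comap f hf) hD

/-- An embedding of the plane as the open half-plane on the side given by the sign of `c`. -/
def side (c : ℝ) (p : Plane) : Plane := (c * Real.exp p.1, p.2)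

theorem side_injective {c : ℝ} (hc : c ≠ 0) : Function.Injective (side c) := by
  rintro ⟨a, b⟩ ⟨a', b'⟩ h
  obtain ⟨h1, h2⟩ := Prod.mk.inj h
  exact Prod.ext (Real.exp_injective (mul_left_cancel₀ hc h1)) h2

theorem continuous_side (c : ℝ) : Continuous (side c) := by
  unfold side
  fun_prop

theorem side_ne (p q : Plane) : side (-1) p ≠ side 1 q := by
  intro h
  have h : -1 * Real.exp p.1 = 1 * Real.exp q.1 := congrArg Prod.fst h
  linarith [Real.exp_pos p.1, Real.exp_pos q.1]

/-- Two drawings side by side. -/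
def sum (D : Drawing G) (E : Drawing H) : Drawing (G ⊕g H) where
  vert := Sum.elim (side (-1) ∘ D.vert) (side 1 ∘ E.vert)
  vert_inj := ((side_injective (by norm_num)).comp D.vert_inj).sumElim
    ((side_injective (by norm_num)).comp E.vert_inj) fun _ _ => side_ne _ _
  arc e := Sum.elim (fun e => side (-1) ∘ D.arc e) (fun e => side 1 ∘ E.arc e)
    (SimpleGraph.edgeSetSumEquiv e)
  arc_cont e := by
    rcases SimpleGraph.edgeSetSumEquiv e with e | e
    · exact (continuous_side _).comp_continuousOn (D.arc_cont e)
    · exact (continuous_side _).comp_continuousOn (E.arc_cont e)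
  arc_injOn e := by
    rcases SimpleGraph.edgeSetSumEquiv e with e | e
    · exact (side_injective (by norm_num)).comp_injOn (D.arc_injOn e)
    · exact (side_injective (by norm_num)).comp_injOn (E.arc_injOn e)
  arc_ends e := by
    obtain ⟨e, rfl⟩ := SimpleGraph.edgeSetSumEquiv.symm.surjective e
    rw [Equiv.apply_symm_apply]
    rcases e with ⟨⟨a, b⟩, he⟩ | ⟨⟨a, b⟩, he⟩
    · obtain ⟨x, y, hxy, h0, h1⟩ := D.arc_ends ⟨s(a, b), he⟩
      exact ⟨.inl x, .inl y, congrArg (Sym2.map Sum.inl) hxy, congrArg (side (-1)) h0,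
        congrArg (side (-1)) h1⟩
    · obtain ⟨x, y, hxy, h0, h1⟩ := E.arc_ends ⟨s(a, b), he⟩
      exact ⟨.inr x, .inr y, congrArg (Sym2.map Sum.inr) hxy, congrArg (side 1) h0,
        congrArg (side 1) h1⟩
  arc_avoid e t ht := by
    rcases SimpleGraph.edgeSetSumEquiv e with e | e
    · rintro ⟨v | v, h⟩
      · exact D.arc_avoid e t ht ⟨v, side_injective (by norm_num) h⟩
      · exact absurd h (side_ne _ _)
    · rintro ⟨v | v, h⟩
      · exact absurd h.symm (side_ne _ _)
      · exact E.arc_avoid e t ht ⟨v, side_injective (by norm_num) h⟩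

theorem crossSet_sum_subset (D : Drawing G) (E : Drawing H) : (D.sum E).CrossSet ⊆
    Prod.map (side (-1)) (Sym2.map (SimpleGraph.edgeSetSumEquiv.symm ∘ Sum.inl)) '' D.CrossSet ∪
    Prod.map (side 1) (Sym2.map (SimpleGraph.edgeSetSumEquiv.symm ∘ Sum.inr)) '' E.CrossSet := by
  rintro ⟨p, _⟩ ⟨e, f, hne, rfl, h1, h2⟩
  obtain ⟨e, rfl⟩ := SimpleGraph.edgeSetSumEquiv.symm.surjective e
  obtain ⟨f, rfl⟩ := SimpleGraph.edgeSetSumEquiv.symm.surjective f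
  have hne : e ≠ f := fun h => hne (h ▸ rfl)
  obtain ⟨s, hs, hs'⟩ := h1
  obtain ⟨t, ht, ht'⟩ := h2
  simp only [sum, Equiv.apply_symm_apply] at hs' ht'
  rcases e with e | e <;> rcases f with f | f
  · obtain rfl := hs'
    exact Or.inl ⟨(D.arc e s, s(e, f)), ⟨e, f, fun h => hne (h ▸ rfl), rfl, ⟨s, hs, rfl⟩,
      ⟨t, ht, side_injective (by norm_num) ht'⟩⟩, rfl⟩
  · exact absurd (hs'.trans ht'.symm) (side_ne _ _)
  · exact absurd (ht'.trans hs'.symm) (side_ne _ _)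
  · obtain rfl := hs'
    exact Or.inr ⟨(E.arc e s, s(e, f)), ⟨e, f, fun h => hne (h ▸ rfl), rfl, ⟨s, hs, rfl⟩,
      ⟨t, ht, side_injective (by norm_num) ht'⟩⟩, rfl⟩

theorem _root_.crNum_sum (hG : ∃ D : Drawing G, D.CrossSet.Finite)
    (hH : ∃ D : Drawing H, D.CrossSet.Finite) : crNum (G ⊕g H) = crNum G + crNum H := by
  obtain ⟨D, hD, hD'⟩ := exists_ncard_eq_crNum hG
  obtain ⟨E, hE, hE'⟩ := exists_ncard_eq_crNum hH
  have hfin := ((hD.image _).union (hE.image _)).subset (D.crossSet_sum_subset E)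
  refine le_antisymm ?_ ?_
  · rw [← hD', ← hE']
    calc _ ≤ (D.sum E).CrossSet.ncard := crNum_le _ hfin
      _ ≤ _ := ncard_le_ncard (D.crossSet_sum_subset E) ((hD.image _).union (hE.image _))
      _ ≤ _ := ncard_union_le _ _
      _ ≤ _ := add_le_add (ncard_image_le hD) (ncard_image_le hE)
  · obtain ⟨F, hF, hF'⟩ := exists_ncard_eq_crNum ⟨_, hfin⟩
    let f : G →g G ⊕g H := SimpleGraph.Embedding.sumInl.toHom
    let g : H →g G ⊕g H := SimpleGraph.Embedding.sumInr.toHom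
    have hf : Function.Injective f := Sum.inl_injective
    have hg : Function.Injective g := Sum.inr_injective
    calc _ ≤ (F.comap f hf).CrossSet.ncard + (F.comap g hg).CrossSet.ncard :=
        add_le_add (crNum_le _ (F.finite_crossSet_comap f hf hF))
          (crNum_le _ (F.finite_crossSet_comap g hg hF))
      _ = _ := by
        rw [← F.ncard_crossSet_comap f, ← F.ncard_crossSet_comap g]
      _ = _ := (ncard_union_eq ?_ (hF.subset (F.crossSet_comap f hf))
        (hF.subset (F.crossSet_comap g hg))).symm
      _ ≤ _ := ncard_le_ncard (union_subset (F.crossSet_comap f hf) (F.crossSet_comap g hg)) hF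
      _ = _ := hF'
    rw [Set.disjoint_left]
    rintro _ ⟨⟨p, _⟩, ⟨⟨⟨a, b⟩, he⟩, e', -, rfl, -⟩, rfl⟩
      ⟨⟨q, _⟩, ⟨⟨⟨c, d⟩, hk⟩, ⟨⟨c', d'⟩, hk'⟩, -, rfl, -⟩, h⟩
    obtain ⟨-, h⟩ := Prod.mk.inj h
    rcases Sym2.eq_iff.1 h with ⟨h, -⟩ | ⟨-, h⟩
    all_goals
      have h := congrArg Subtype.val h
      rcases Sym2.eq_iff.1 h with ⟨h, -⟩ | ⟨h, -⟩ <;> cases h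

end Drawing

theorem interleave_of_arcs_meet {a b c d x : ℝ} (ha : a < x) (hb : x < b) (hc : c < x) (hd : x < d)
    (h : (x - a) * (b - x) = (x - c) * (d - x)) (hne : a ≠ c ∨ b ≠ d) :
    (a < c ∧ b < d) ∨ (c < a ∧ d < b) := by
  rcases lt_trichotomy a c with hac | rfl | hac
  · left
    refine ⟨hac, ?_⟩
    by_contra! hbd
    nlinarith [mul_pos (sub_pos.2 hac) (sub_pos.2 hb), mul_nonneg (sub_pos.2 hc).le
      (sub_nonneg.2 hbd)]
  · have := mul_left_cancel₀ (sub_pos.2 ha).ne' h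
    exact absurd (by linarith) (hne.resolve_left (by simp))
  · right
    refine ⟨hac, ?_⟩
    by_contra! hbd
    nlinarith [mul_pos (sub_pos.2 hac) (sub_pos.2 hd), mul_nonneg (sub_pos.2 ha).le
      (sub_nonneg.2 hbd)]

theorem arcs_meet_unique {a b c d x y : ℝ} (h : (a < c ∧ b < d) ∨ (c < a ∧ d < b))
    (hx : (x - a) * (b - x) = (x - c) * (d - x)) (hy : (y - a) * (b - y) = (y - c) * (d - y)) :
    x = y := by
  have hne : a + b - c - d ≠ 0 := by
    rcases h with h | h
    · linarith
    · exact ne_of_gt (by linarith)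
  apply mul_right_cancel₀ hne
  linarith

section

variable {V : Type*} {G : SimpleGraph V}

theorem exists_ordered_ends {p : V → ℕ} (hp : Function.Injective p) (e : G.edgeSet) :
    ∃ a b, (e : Sym2 V) = s(a, b) ∧ p a < p b := by
  obtain ⟨⟨a, b⟩, he⟩ := e
  rcases (hp.ne (G.ne_of_adj he)).lt_or_gt with h | h
  exacts [⟨a, b, rfl, h⟩, ⟨b, a, Sym2.eq_swap, h⟩]

theorem exists_book_drawing {p : V → ℕ} (hp : Function.Injective p) (page : Sym2 V → Bool) :
    ∃ (D : Drawing G) (lo hi : G.edgeSet → V), (∀ e : G.edgeSet, (e : Sym2 V) = s(lo e, hi e)) ∧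
      ∀ e : G.edgeSet, ∀ q ∈ D.interOf e, (p (lo e) : ℝ) < q.1 ∧ q.1 < p (hi e) ∧
        q.2 = (if page e then 1 else -1) * ((q.1 - p (lo e)) * (p (hi e) - q.1)) := by
  choose lo hi he hlt using fun e : G.edgeSet => exists_ordered_ends hp e
  have hlt' : ∀ e, 0 < (p (hi e) - p (lo e) : ℝ) := fun e => sub_pos.2 (by exact_mod_cast hlt e)
  let σ : G.edgeSet → ℝ := fun e => if page e then 1 else -1
  have hσ : ∀ e, σ e ≠ 0 := fun e => by
    simp only [σ]
    split_ifs <;> norm_num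
  refine ⟨{
    vert := fun v => (p v, 0)
    vert_inj := fun v w h => hp (Nat.cast_injective (R := ℝ) (congrArg Prod.fst h))
    arc := fun e t => (p (lo e) + t * (p (hi e) - p (lo e)),
      σ e * (t * (1 - t) * (p (hi e) - p (lo e)) ^ 2))
    arc_cont := fun e => by fun_prop
    arc_injOn := fun e s _ t _ h => mul_right_cancel₀ (hlt' e).ne'
      (add_left_cancel (congrArg Prod.fst h))
    arc_ends := fun e => ⟨lo e, hi e, he e, by simp, by simp⟩
    arc_avoid := ?_ }, lo, hi, he, ?_⟩
  · rintro e t - ⟨v, h⟩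
    have h : σ e * (t * (1 - t) * (p (hi e) - p (lo e)) ^ 2) = 0 := congrArg Prod.snd h
    have := (hlt' e).ne'
    simp only [mul_eq_zero, hσ, false_or, pow_eq_zero_iff, ne_eq, OfNat.ofNat_ne_zero,
      not_false_eq_true, this, or_false] at h
    exact h.imp_right fun h => by linarith
  · rintro e _ ⟨t, ⟨h0, h1⟩, rfl⟩
    have := hlt' e
    refine ⟨?_, ?_, ?_⟩
    · simpa using mul_pos h0 this
    · nlinarith [mul_pos (sub_pos.2 h1) this]
    · simp only [σ]
      ring

/-- The crossing number is bounded by the number of interleaving pairs of a book drawing. -/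
theorem crNum_le_of_book {p : V → ℕ} (hp : Function.Injective p) (page : Sym2 V → Bool)
    {T : Set (Sym2 (Sym2 V))} (hT : T.Finite)
    (h : ∀ a b c d, G.Adj a b → G.Adj c d → p a < p c → p c < p b → p b < p d →
      page s(a, b) = page s(c, d) → s(s(a, b), s(c, d)) ∈ T) :
    (∃ D : Drawing G, D.CrossSet.Finite) ∧ crNum G ≤ T.ncard := by
  obtain ⟨D, lo, hi, he, hD⟩ := exists_book_drawing (G := G) hp page
  have key : ∀ e f : G.edgeSet, e ≠ f → ∀ q ∈ D.interOf e, q ∈ D.interOf f → page e = page f ∧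
      (q.1 - p (lo e)) * (p (hi e) - q.1) = (q.1 - p (lo f)) * (p (hi f) - q.1) ∧
      (((p (lo e) : ℝ) < p (lo f) ∧ (p (hi e) : ℝ) < p (hi f)) ∨
        ((p (lo f) : ℝ) < p (lo e) ∧ (p (hi f) : ℝ) < p (hi e))) := by
    intro e f hef q hqe hqf
    obtain ⟨h1, h2, h3⟩ := hD e q hqe
    obtain ⟨h4, h5, h6⟩ := hD f q hqf
    have hpe := mul_pos (sub_pos.2 h1) (sub_pos.2 h2)
    have hpf := mul_pos (sub_pos.2 h4) (sub_pos.2 h5)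
    have hpage : page e = page f ∧
        (q.1 - p (lo e)) * (p (hi e) - q.1) = (q.1 - p (lo f)) * (p (hi f) - q.1) := by
      rw [h3] at h6
      rcases h7 : page e <;> rcases h8 : page f <;> simp only [h7, h8] at h6 ⊢ <;>
        norm_num at h6 ⊢ <;> linarith
    refine ⟨hpage.1, hpage.2, interleave_of_arcs_meet h1 h2 h4 h5 hpage.2 ?_⟩
    by_contra! h
    refine hef (Subtype.ext ?_)
    rw [he, he, hp (by exact_mod_cast h.1 : p (lo e) = p (lo f)),
      hp (by exact_mod_cast h.2 : p (hi e) = p (hi f))]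
  have hmap : MapsTo (fun x : Plane × Sym2 G.edgeSet => x.2.map Subtype.val) D.CrossSet T := by
    have key' : ∀ e f : G.edgeSet, ∀ q ∈ D.interOf e, q ∈ D.interOf f → page e = page f →
        (p (lo e) : ℝ) < p (lo f) ∧ (p (hi e) : ℝ) < p (hi f) → s((e : Sym2 V), (f : Sym2 V)) ∈ T := by
      intro e f q hqe hqf hpage ⟨h1, h2⟩
      have h3 := (hD f q hqf).1.trans (hD e q hqe).2.1
      have ha : G.Adj (lo e) (hi e) := by
        rw [← SimpleGraph.mem_edgeSet, ← he]
        exact e.2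
      have hb : G.Adj (lo f) (hi f) := by
        rw [← SimpleGraph.mem_edgeSet, ← he]
        exact f.2
      rw [he e, he f] at hpage ⊢
      exact h _ _ _ _ ha hb (by exact_mod_cast h1) (by exact_mod_cast h3) (by exact_mod_cast h2)
        hpage
    rintro ⟨q, _⟩ ⟨e, f, hef, rfl, hqe, hqf⟩
    obtain ⟨h1, -, h3⟩ := key e f hef q hqe hqf
    rcases h3 with h3 | h3
    · exact key' e f q hqe hqf h1 h3
    · have := key' f e q hqf hqe h1.symm h3
      rw [Sym2.eq_swap] at this
      exact this
  have hinj : InjOn (fun x : Plane × Sym2 G.edgeSet => x.2.map Subtype.val) D.CrossSet := by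
    rintro ⟨q, _⟩ ⟨e, f, hef, rfl, hqe, hqf⟩ ⟨q', _⟩ ⟨e', f', hef', rfl, hqe', hqf'⟩ hxy
    have hxy := Sym2.map.injective Subtype.val_injective hxy
    dsimp only at hqe hqf hqe' hqf' hxy
    have hq : q' ∈ D.interOf e ∧ q' ∈ D.interOf f := by
      rcases Sym2.eq_iff.1 hxy with ⟨rfl, rfl⟩ | ⟨rfl, rfl⟩
      exacts [⟨hqe', hqf'⟩, ⟨hqf', hqe'⟩]
    obtain ⟨-, h2, h3⟩ := key e f hef q hqe hqf
    obtain ⟨-, h2', -⟩ := key e f hef q' hq.1 hq.2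
    have h1 := arcs_meet_unique h3 h2 h2'
    have h2 : q.2 = q'.2 := by rw [(hD e q hqe).2.2, (hD e q' hq.1).2.2, h1]
    exact Prod.ext (Prod.ext h1 h2) hxy
  have hfin : D.CrossSet.Finite := .of_injOn hmap hinj hT
  exact ⟨⟨D, hfin⟩, (D.crNum_le hfin).trans (ncard_le_ncard_of_injOn _ hmap hinj hT)⟩

theorem exists_finite_crossSet [Finite V] : ∃ D : Drawing G, D.CrossSet.Finite := by
  obtain ⟨p, hp⟩ := exists_injective_nat V
  exact (crNum_le_of_book hp (fun _ => true) (toFinite univ) fun _ _ _ _ _ _ _ _ _ _ => mem_univ _).1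

end

theorem crNum_K33 : crNum K33 = 1 := by
  let p : Fin 3 ⊕ Fin 3 → ℕ := Sum.elim (fun i => 2 * i) (fun i => 2 * i + 1)
  have hp : Function.Injective p := by decide
  have hle := (crNum_le_of_book (G := K33) hp (fun z => decide (z = s(.inl 1, .inr 2)))
    (T := {s(s(.inl 0, .inr 1), s(.inr 0, .inl 2))}) (toFinite _) (by
      simp only [mem_singleton_iff, completeBipartiteGraph_adj]
      decide)).2
  obtain ⟨D, hD, h⟩ := Drawing.exists_ncard_eq_crNum (G := K33) exists_finite_crossSet
  rw [ncard_singleton] at hle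
  have := (ncard_pos hD).2 D.crossSet_K33_nonempty
  omega

/-- Positions on the spine of the book drawing of the heavy graph. -/
def block : BaseVertex ⊕ BaseEdge → ℕ
  | .inl .u => 0
  | .inl .v => 13
  | .inl (.b false false) => 3
  | .inl (.b false true) => 6
  | .inl (.a false true) => 8
  | .inl (.a false false) => 11
  | .inl (.b true false) => 23
  | .inl (.b true true) => 20
  | .inl (.a true true) => 18
  | .inl (.a true false) => 15
  | .inr (.hu false true) => 1
  | .inr (.hu false false) => 2
  | .inr (.hm false false) => 4
  | .inr (.rb false) => 5
  | .inr (.hm false true) => 7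
  | .inr (.hv false true) => 9
  | .inr (.ra false) => 10
  | .inr (.hv false false) => 12
  | .inr (.hu true true) => 25
  | .inr (.hu true false) => 24
  | .inr (.hm true false) => 22
  | .inr (.rb true) => 21
  | .inr (.hm true true) => 19
  | .inr (.hv true true) => 17
  | .inr (.ra true) => 16
  | .inr (.hv true false) => 14
  | .inr (.la i s) => 27 + 2 * i.toNat + s.toNat
  | .inr (.lb i s) => 31 + 2 * i.toNat + s.toNat

theorem block_injective : Function.Injective block := by decide

/-- Whether the first half of a heavy edge is on the upper page. -/
def BaseEdge.page : BaseEdge → Bool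
  | hm _ _ | ra _ | rb _ => true
  | _ => false

/-- The side of a vertex. -/
def BaseVertex.side : BaseVertex → Bool
  | a _ s | b _ s => s
  | _ => false

/-- The page of an edge with given ends. -/
def blockPage : BaseVertex ⊕ BaseEdge → BaseVertex ⊕ BaseEdge → Bool
  | .inl x, .inl y => x.side || y.side
  | .inl x, .inr e => e.page == decide (x = e.src)
  | .inr e, .inl x => e.page == decide (x = e.src)
  | _, _ => false

theorem blockPage_comm : ∀ x y, blockPage x y = blockPage y x
  | .inl _, .inl _ => Bool.or_comm _ _
  | .inl _, .inr _ | .inr _, .inl _ | .inr _, .inr _ => rfl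

/-- The pieces of the edges of the base graph, in both directions. -/
def blockDart (e : BaseEdge) (s : Bool) : Bool → (BaseVertex ⊕ BaseEdge) × (BaseVertex ⊕ BaseEdge)
  | true => if e.light then (.inl e.src, .inl e.tgt) else
      if s then (.inl e.src, .inr e) else (.inr e, .inl e.tgt)
  | false => if e.light then (.inl e.tgt, .inl e.src) else
      if s then (.inr e, .inl e.src) else (.inl e.tgt, .inr e)

/-- The relation on blocks induced by the order of the spine. -/
def BlockLT (x y : BaseVertex ⊕ BaseEdge) : Prop :=
  block x < block y ∨ (x.isRight = true ∧ x = y)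

instance (x y : BaseVertex ⊕ BaseEdge) : Decidable (BlockLT x y) :=
  inferInstanceAs (Decidable (_ ∨ _))

/-- The four pairs of light edges which cross in the book drawing. -/
theorem blockDart_interleave : ∀ e s o f t r,
    BlockLT (blockDart e s o).1 (blockDart f t r).1 →
    BlockLT (blockDart f t r).1 (blockDart e s o).2 →
    BlockLT (blockDart e s o).2 (blockDart f t r).2 →
    blockPage (blockDart e s o).1 (blockDart e s o).2 =
      blockPage (blockDart f t r).1 (blockDart f t r).2 →
    ∃ i j, blockDart e s o = (.inl .u, .inl (.a i j)) ∧
      (blockDart f t r = (.inl (.b i j), .inl .v) ∨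
        blockDart f t r = (.inl .v, .inl (.b i j))) := by
  decide +kernel

/-- The block of a vertex of the heavy graph. -/
def toBlock {M : ℕ} : BaseVertex ⊕ BaseEdge × Fin M → BaseVertex ⊕ BaseEdge := Sum.map id Prod.fst

/-- The position of a vertex of the heavy graph on the spine. -/
def spine {M : ℕ} (x : BaseVertex ⊕ BaseEdge × Fin M) : ℕ :=
  (M + 1) * block (toBlock x) + Sum.elim (fun _ => 0) (fun x => (x.2 : ℕ)) x

theorem spine_div {M : ℕ} (x : BaseVertex ⊕ BaseEdge × Fin M) :
    spine x / (M + 1) = block (toBlock x) := by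
  rw [spine, Nat.mul_add_div (by omega), Nat.div_eq_of_lt, add_zero]
  rcases x with x | ⟨e, j⟩
  · simp
  · exact j.2.trans (by omega)

theorem spine_injective {M : ℕ} :
    Function.Injective (spine : BaseVertex ⊕ BaseEdge × Fin M → ℕ) := by
  intro x y h
  have hb := block_injective ((spine_div x).symm.trans (h ▸ spine_div y))
  have h : _ = _ := h
  rw [spine, spine, hb, Nat.add_left_cancel_iff] at h
  rcases x with x | ⟨e, j⟩ <;> rcases y with y | ⟨f, k⟩ <;> simp_all [toBlock, Fin.ext_iff]

theorem blockLT_of_spine_lt {M : ℕ} {x y : BaseVertex ⊕ BaseEdge × Fin M} (h : spine x < spine y) :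
    BlockLT (toBlock x) (toBlock y) := by
  have hle := Nat.div_le_div_right (c := M + 1) h.le
  rw [spine_div, spine_div] at hle
  rcases hle.lt_or_eq with hlt | heq
  · exact Or.inl hlt
  · have heq := block_injective heq
    refine Or.inr ⟨?_, heq⟩
    rcases x with x | x
    · rcases y with y | y
      · simp only [toBlock, Sum.map_inl, id, Sum.inl.injEq] at heq
        simp [heq] at h
      · cases heq
    · rfl

theorem exists_blockDart {M : ℕ} {x y : BaseVertex ⊕ BaseEdge × Fin M} (h : (heavyGraph M).Adj x y) :
    ∃ e s o, blockDart e s o = (toBlock x, toBlock y) := by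
  rcases h with ⟨-, h | h⟩
  all_goals
    rcases x with x | ⟨e, j⟩ <;> rcases y with y | ⟨f, k⟩
  · obtain ⟨e, he, rfl, rfl⟩ := h
    exact ⟨e, true, true, by simp [blockDart, he, toBlock]⟩
  · obtain ⟨he, rfl | rfl⟩ := h
    · exact ⟨f, true, true, by simp [blockDart, he, toBlock]⟩
    · exact ⟨f, false, false, by simp [blockDart, he, toBlock]⟩
  · cases h
  · cases h
  · obtain ⟨e, he, rfl, rfl⟩ := h
    exact ⟨e, true, false, by simp [blockDart, he, toBlock]⟩
  · cases h
  · obtain ⟨he, rfl | rfl⟩ := h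
    · exact ⟨e, true, false, by simp [blockDart, he, toBlock]⟩
    · exact ⟨e, false, true, by simp [blockDart, he, toBlock]⟩
  · cases h

theorem toBlock_eq_inl {M : ℕ} {x : BaseVertex ⊕ BaseEdge × Fin M} {y : BaseVertex}
    (h : toBlock x = .inl y) : x = .inl y := by
  rcases x with x | x
  · simpa [toBlock] using h
  · cases h

theorem crNum_heavyGraph_le (M : ℕ) : crNum (heavyGraph M) ≤ 4 := by
  let g : Bool × Bool → Sym2 (Sym2 (BaseVertex ⊕ BaseEdge × Fin M)) := fun i =>
    s(s(.inl .u, .inl (.a i.1 i.2)), s(.inl .v, .inl (.b i.1 i.2)))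
  refine (crNum_le_of_book spine_injective
    (Sym2.lift ⟨fun x y => blockPage (toBlock x) (toBlock y), fun _ _ => blockPage_comm _ _⟩)
    (T := range g) (finite_range g) ?_).2.trans ?_
  · intro a b c d hab hcd h1 h2 h3 hpage
    obtain ⟨e, s, o, he⟩ := exists_blockDart hab
    obtain ⟨f, t, r, hf⟩ := exists_blockDart hcd
    have key := blockDart_interleave e s o f t r
    rw [he, hf] at key
    simp only [Prod.mk.injEq] at key
    obtain ⟨i, j, ⟨ha, hb⟩, hcd⟩ := key (blockLT_of_spine_lt h1) (blockLT_of_spine_lt h2)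
      (blockLT_of_spine_lt h3) hpage
    refine ⟨(i, j), ?_⟩
    rw [toBlock_eq_inl ha, toBlock_eq_inl hb]
    rcases hcd with ⟨hc, hd⟩ | ⟨hc, hd⟩
    · rw [toBlock_eq_inl hc, toBlock_eq_inl hd]
      exact congrArg (fun z => s(_, z)) Sym2.eq_swap
    · rw [toBlock_eq_inl hc, toBlock_eq_inl hd]
  · rw [← image_univ]
    exact (ncard_image_le finite_univ).trans (by simp [ncard_univ])

/-- The projective line with affine equation `y = s * x - m`. -/
def RP2.line (s m : ℝ) : Set RP2 :=
  {q | Quotient.lift (s := projSetoid) (fun v => v.1 1 = s * v.1 0 - m * v.1 2) (by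
    rintro v w ⟨c, hc, h⟩
    simp only [← h, Pi.smul_apply, smul_eq_mul, eq_iff_iff]
    rw [← mul_right_inj' hc]
    ring_nf) q}

theorem RP2.mem_line {s m : ℝ} {v : {v : Fin 3 → ℝ // v ≠ 0}} :
    (Quotient.mk projSetoid v : RP2) ∈ RP2.line s m ↔ v.1 1 = s * v.1 0 - m * v.1 2 := Iff.rfl

theorem RP2.compl_line (s m : ℝ) : IsConnected (RP2.line s m)ᶜ := by
  let h : ℝ × ℝ → {v : Fin 3 → ℝ // v ≠ 0} := fun p => ⟨![p.1, s * p.1 - m * p.2 - 1, p.2], by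
    intro h
    have h0 := congrFun h 0
    have h1 := congrFun h 1
    have h2 := congrFun h 2
    simp at h0 h1 h2
    simp [h0, h2] at h1⟩
  have hc : Continuous h := by
    refine Continuous.subtype_mk (continuous_pi fun i => ?_) _
    fin_cases i <;> simp <;> fun_prop
  suffices hr : (RP2.line s m)ᶜ = range fun p => (Quotient.mk projSetoid (h p) : RP2) by
    rw [hr]
    exact isConnected_range (continuous_quotient_mk'.comp hc)
  ext q
  constructor
  · induction q using Quotient.ind with | _ v
    intro hv
    have hv : v.1 1 ≠ s * v.1 0 - m * v.1 2 := hv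
    have hw : s * v.1 0 - m * v.1 2 - v.1 1 ≠ 0 := sub_ne_zero.2 hv.symm
    refine ⟨(v.1 0 / (s * v.1 0 - m * v.1 2 - v.1 1), v.1 2 / (s * v.1 0 - m * v.1 2 - v.1 1)),
      Quotient.sound ⟨_, hw, ?_⟩⟩
    ext i
    fin_cases i <;> simp [h] <;> field_simp
    ring
  · rintro ⟨p, rfl⟩ hp
    have hp : s * p.1 - m * p.2 - 1 = s * p.1 - m * p.2 := hp
    linarith

theorem RP2.isPseudoline_line (s m : ℝ) : IsPseudoline (RP2.line s m) := by
  open Real in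
  let h : ℝ → {v : Fin 3 → ℝ // v ≠ 0} := fun t =>
    ⟨![cos (π * t), s * cos (π * t) - m * sin (π * t), sin (π * t)], by
      intro h
      have h0 : cos (π * t) = 0 := congrFun h 0
      have h2 : sin (π * t) = 0 := congrFun h 2
      simpa [h0, h2] using sin_sq_add_cos_sq (π * t)⟩
  have hc : Continuous h := by
    refine Continuous.subtype_mk (continuous_pi fun i => ?_) _
    fin_cases i <;> simp <;> fun_prop
  let g : ℝ → RP2 := fun t => Quotient.mk projSetoid (h t)
  have hg : Function.Periodic g 1 := by
    intro t
    refine Quotient.sound ⟨-1, by norm_num, ?_⟩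
    have h1 : Real.pi * (t + 1) = Real.pi * t + Real.pi := by ring
    ext i
    fin_cases i <;> simp [h, h1]
    ring
  refine ⟨hg.lift, continuous_coinduced_dom.2 (continuous_quotient_mk'.comp hc), ?_, ?_,
    RP2.compl_line s m⟩
  · intro a b hab
    induction a using QuotientAddGroup.induction_on with | _ x
    induction b using QuotientAddGroup.induction_on with | _ y
    obtain ⟨c, hc, hxy⟩ := Quotient.exact hab
    have h0 : c * Real.cos (Real.pi * x) = Real.cos (Real.pi * y) := congrFun hxy 0
    have h2 : c * Real.sin (Real.pi * x) = Real.sin (Real.pi * y) := congrFun hxy 2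
    have : Real.sin (Real.pi * y - Real.pi * x) = 0 := by
      rw [Real.sin_sub, ← h0, ← h2]
      ring
    obtain ⟨n, hn⟩ := Real.sin_eq_zero_iff.1 this
    have hn : (n : ℝ) = y - x := mul_left_cancel₀ Real.pi_ne_zero (by linarith)
    refine QuotientAddGroup.eq.2 (AddSubgroup.mem_zmultiples_iff.2 ⟨n, ?_⟩)
    simp [hn]
    ring
  · ext q
    constructor
    · rintro ⟨a, rfl⟩
      induction a using QuotientAddGroup.induction_on with | _ x
      exact (RP2.mem_line (v := h x)).2 rfl
    · induction q using Quotient.ind with | _ v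
      intro hv
      have hv : v.1 1 = s * v.1 0 - m * v.1 2 := hv
      let z : ℂ := ⟨v.1 0, v.1 2⟩
      have hz : z ≠ 0 := by
        intro hz
        have h0 : v.1 0 = 0 := congrArg Complex.re hz
        have h2 : v.1 2 = 0 := congrArg Complex.im hz
        refine v.2 (funext fun i => ?_)
        fin_cases i
        exacts [h0, by simp [hv, h0, h2], h2]
      refine ⟨((z.arg / Real.pi : ℝ) : AddCircle (1 : ℝ)),
        Quotient.sound ⟨‖z‖, norm_ne_zero_iff.2 hz, ?_⟩⟩
      have h0 : ‖z‖ * Real.cos z.arg = v.1 0 := Complex.norm_mul_cos_arg z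
      have h2 : ‖z‖ * Real.sin z.arg = v.1 2 := Complex.norm_mul_sin_arg z
      have hpi : Real.pi * (z.arg / Real.pi) = z.arg := mul_div_cancel₀ _ Real.pi_ne_zero
      ext i
      fin_cases i
      · simpa [h, hpi] using h0
      · change ‖z‖ * (s * Real.cos (Real.pi * (z.arg / Real.pi)) -
          m * Real.sin (Real.pi * (z.arg / Real.pi))) = v.1 1
        rw [hpi, hv]
        linear_combination s * h0 - m * h2
      · simpa [h, hpi] using h2

theorem RP2.line_inter {s m s' m' : ℝ} (h : s ≠ s' ∨ m ≠ m') :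
    ∃! q, q ∈ RP2.line s m ∧ q ∈ RP2.line s' m' := by
  have hne : (![m - m', s * (m - m') - m * (s - s'), s - s'] : Fin 3 → ℝ) ≠ 0 := by
    intro h'
    have h0 : m - m' = 0 := congrFun h' 0
    have h2 : s - s' = 0 := congrFun h' 2
    rcases h with h | h
    exacts [h (sub_eq_zero.1 h2), h (sub_eq_zero.1 h0)]
  refine ⟨Quotient.mk projSetoid ⟨_, hne⟩, ⟨?_, ?_⟩, ?_⟩
  · rfl
  · change s * (m - m') - m * (s - s') = s' * (m - m') - m' * (s - s')
    ring
  · intro q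
    induction q using Quotient.ind with | _ v
    rintro ⟨hv, hv'⟩
    have hv : v.1 1 = s * v.1 0 - m * v.1 2 := hv
    have hv' : v.1 1 = s' * v.1 0 - m' * v.1 2 := hv'
    have key : ∃ c : ℝ, v.1 0 = c * (m - m') ∧ v.1 2 = c * (s - s') := by
      rcases h with h | h
      · have := sub_ne_zero.2 h
        refine ⟨v.1 2 / (s - s'), ?_, ?_⟩ <;> field_simp
        linarith
      · have := sub_ne_zero.2 h
        refine ⟨v.1 0 / (m - m'), ?_, ?_⟩ <;> field_simp
        linarith
    obtain ⟨c, h0, h2⟩ := key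
    refine (Quotient.sound (s := projSetoid) (a := ⟨_, hne⟩) (b := v) ⟨c, ?_, ?_⟩).symm
    · rintro rfl
      refine v.2 (funext fun i => ?_)
      fin_cases i <;> simp [hv, h0, h2]
    · ext i
      fin_cases i <;> simp [hv, h0, h2]
      ring

theorem planeToRP2_injective : Function.Injective planeToRP2 := fun p q h => by
  rw [← Drawing.affine_equivRealProd_symm, ← Drawing.affine_equivRealProd_symm] at h
  exact Complex.equivRealProd.symm.injective (affine_injective h)

theorem Drawing.IsPseudolinear.finite_crossSet {V : Type*} {G : SimpleGraph V} [Finite V]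
    {D : Drawing G} (hD : D.IsPseudolinear) : D.CrossSet.Finite := by
  obtain ⟨L, -, hLD, hL⟩ := hD
  refine Set.Finite.of_finite_image (f := Prod.snd) (toFinite _) ?_
  have hmem : ∀ e, ∀ z ∈ D.interOf e, planeToRP2 z ∈ L e := by
    rintro e - ⟨t, ht, rfl⟩
    exact hLD e t (Ioo_subset_Icc_self ht)
  rintro ⟨z, -⟩ ⟨e, f, hef, rfl, hze, hzf⟩ ⟨w, -⟩ ⟨e', f', -, rfl, hwe, hwf⟩ h
  refine Prod.ext (planeToRP2_injective ((hL e f hef).unique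
    ⟨hmem _ _ hze, hmem _ _ hzf⟩ ?_)) h
  have h : s(e, f) = s(e', f') := h
  rcases Sym2.eq_iff.1 h with ⟨rfl, rfl⟩ | ⟨rfl, rfl⟩
  exacts [⟨hmem _ _ hwe, hmem _ _ hwf⟩, ⟨hmem _ _ hwf, hmem _ _ hwe⟩]

theorem exists_isPseudolinear {V : Type*} {G : SimpleGraph V} [Finite V] :
    ∃ D : Drawing G, D.IsPseudolinear := by
  obtain ⟨p, hp⟩ := exists_injective_nat V
  choose lo hi he hlt using fun e : G.edgeSet => exists_ordered_ends hp e
  have hlt' : ∀ e, (p (lo e) : ℝ) < p (hi e) := fun e => by exact_mod_cast hlt e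
  let arc : G.edgeSet → ℝ → Plane := fun e t =>
    (p (lo e) + t * (p (hi e) - p (lo e)), p (lo e) ^ 2 + t * (p (hi e) ^ 2 - p (lo e) ^ 2))
  refine ⟨{
    vert := fun v => (p v, (p v : ℝ) ^ 2)
    vert_inj := fun v w h => hp (Nat.cast_injective (R := ℝ) (congrArg Prod.fst h))
    arc := arc
    arc_cont := fun e => by fun_prop
    arc_injOn := fun e t _ u _ h => mul_right_cancel₀ (sub_pos.2 (hlt' e)).ne'
      (add_left_cancel (congrArg Prod.fst h))
    arc_ends := fun e => ⟨lo e, hi e, he e, by simp [arc], by simp [arc]⟩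
    arc_avoid := ?_ }, fun e => RP2.line (p (lo e) + p (hi e)) (p (lo e) * p (hi e)),
    fun e => RP2.isPseudoline_line _ _, fun e t _ => ?_, fun e f hef => RP2.line_inter ?_⟩
  · rintro e t - ⟨v, h⟩
    have h1 : (p (lo e) + t * (p (hi e) - p (lo e)) : ℝ) = p v := congrArg Prod.fst h
    have h2 : (p (lo e) ^ 2 + t * (p (hi e) ^ 2 - p (lo e) ^ 2) : ℝ) = p v ^ 2 :=
      congrArg Prod.snd h
    have h3 : (t * (t - 1)) * ((p (hi e) - p (lo e)) ^ 2 : ℝ) = 0 := by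
      rw [← h1] at h2
      linear_combination -h2
    rcases mul_eq_zero.1 h3 with h3 | h3
    · exact (mul_eq_zero.1 h3).imp_right sub_eq_zero.1
    · exact absurd h3 (pow_pos (sub_pos.2 (hlt' e)) 2).ne'
  · change (p (lo e) ^ 2 + t * (p (hi e) ^ 2 - p (lo e) ^ 2) : ℝ) =
      (p (lo e) + p (hi e)) * (p (lo e) + t * (p (hi e) - p (lo e))) - p (lo e) * p (hi e) * 1
    ring
  · by_contra! h
    obtain ⟨h1, h2⟩ := h
    have h3 : (p (lo e) - p (lo f) : ℝ) * (p (lo e) - p (hi f)) = 0 := by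
      linear_combination p (lo e) * h1 - h2
    have hle := hlt' e
    have hlf := hlt' f
    have h4 : (p (lo e) : ℝ) = p (lo f) := by
      rcases mul_eq_zero.1 h3 with h | h <;> linarith
    have h5 : (p (hi e) : ℝ) = p (hi f) := by linarith
    refine hef (Subtype.ext ?_)
    rw [he e, he f, hp (Nat.cast_injective h4), hp (Nat.cast_injective h5)]

theorem le_pcrNum {V : Type*} {G : SimpleGraph V} [Finite V] {m : ℕ}
    (f : heavyGraph (2 * m) →g G) (hf : Function.Injective f) : m ≤ pcrNum G := by
  obtain ⟨D, hD⟩ := exists_isPseudolinear (G := G)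
  obtain ⟨E, hE, hfin, h⟩ := Nat.sInf_mem
    (s := {n | ∃ D : Drawing G, D.IsPseudolinear ∧ D.CrossSet.Finite ∧ D.CrossSet.ncard = n})
    ⟨_, D, hD, hD.finite_crossSet, rfl⟩
  rw [pcrNum, crNumP, ← h]
  exact E.le_ncard_crossSet hf (fun _ _ => f.map_rel) hfin hE

theorem exists_crNum_eq_add {V : Type} [Finite V] (G : SimpleGraph V) (n : ℕ) :
    ∃ (W : Type) (_ : Finite W) (H : SimpleGraph W) (f : G →g H),
      Function.Injective f ∧ crNum H = crNum G + n := by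
  induction n with
  | zero => exact ⟨V, inferInstance, G, SimpleGraph.Hom.id, Function.injective_id, rfl⟩
  | succ n ih =>
    obtain ⟨W, _, H, f, hf, h⟩ := ih
    refine ⟨W ⊕ (Fin 3 ⊕ Fin 3), inferInstance, H ⊕g K33,
      SimpleGraph.Embedding.sumInl.toHom.comp f, Sum.inl_injective.comp hf, ?_⟩
    rw [crNum_sum exists_finite_crossSet exists_finite_crossSet, crNum_K33, h, add_assoc]

theorem crNum_congr {V W : Type*} {G : SimpleGraph V} {H : SimpleGraph W} [Finite V] [Finite W]
    (e : G ≃g H) : crNum G = crNum H :=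
  (crNum_mono e.toHom e.injective exists_finite_crossSet).antisymm
    (crNum_mono e.symm.toHom e.symm.injective exists_finite_crossSet)

/-- Theorem. For all integers `k` and `m` with `m ≥ k ≥ 4`, there exists a finite
simple graph `G` such that `cr G = k` and `pcr G ≥ m`. -/
theorem exists_graph_crNum_eq_and_pcrNum_ge (k m : ℕ) (hk : 4 ≤ k) (hm : k ≤ m) :
    ∃ (n : ℕ) (G : SimpleGraph (Fin n)), crNum G = k ∧ m ≤ pcrNum G := by
  obtain ⟨W, _, H, f, hf, h⟩ := exists_crNum_eq_add (heavyGraph (2 * m))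
    (k - crNum (heavyGraph (2 * m)))
  obtain ⟨n, ⟨e⟩⟩ := Finite.exists_equiv_fin W
  let i : H ≃g H.map e.toEmbedding := SimpleGraph.Iso.map e H
  refine ⟨n, H.map e.toEmbedding, ?_, le_pcrNum (i.toHom.comp f) (i.injective.comp hf)⟩
  rw [← crNum_congr i, h, Nat.add_sub_cancel' ((crNum_heavyGraph_le _).trans hk)]

end
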